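/- arXiv:1804.08408 — 5 statements merged into one kernel-verified Lean document; each statement's English description precedes it below -/
import Mathlib

section
/- Assume the setup below, and suppose c solves the normal system: for every k ∈ U, Σ_{j∈Z^S} a(j)^⊤ R(k,j) = Σ_{j∈U} c(j)^⊤ B(k,j) (an identity of row vectors in ℂ^T). Then: (i) (1/2π)∫_{−π}^{π} h(λ)^⊤ e^{−ikλ} dλ = 0 for every k ∈ U; and (ii) for every finitely supported b : ℤ → ℂ^T with support contained in Z₋∖S, setting g(λ) = Σ_{n∈Z₋∖S} b(n) e^{inλ}, one has Δ(h;F,G) ≤ Δ(g;F,G), and Δ(h;F,G) is finite. (This is the deterministic, spectral-domain form of Theorem 1: h is the spectral characteristic of the mean-square optimal linear filter of the functional Aξ from observations with missing values at the points of S.) -/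
open MeasureTheory
open scoped ComplexOrder

/-- the sesquilinear form of a matrix -/
noncomputable def qf {T : ℕ} (N : Matrix (Fin T) (Fin T) ℂ) (x y : Fin T → ℂ) : ℂ :=
  ∑ p, ∑ q, x p * N p q * (starRingEnd ℂ) (y q)

lemma qf_eq {T : ℕ} (N : Matrix (Fin T) (Fin T) ℂ) (x y : Fin T → ℂ) :
    qf N x y = Matrix.vecMul x N ⬝ᵥ star y := by
  simp only [qf, Matrix.vecMul, dotProduct, Finset.sum_mul]
  rw [Finset.sum_comm]
  rfl

lemma qf_eq2 {T : ℕ} (N : Matrix (Fin T) (Fin T) ℂ) (x y : Fin T → ℂ) :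
    qf N x y = x ⬝ᵥ N.mulVec (star y) := by
  rw [qf_eq, Matrix.dotProduct_mulVec]

lemma qf_sub_left {T : ℕ} (N : Matrix (Fin T) (Fin T) ℂ) (x y z : Fin T → ℂ) :
    qf N (x - y) z = qf N x z - qf N y z := by
  simp [qf_eq, Matrix.sub_vecMul, sub_dotProduct]

lemma qf_sub_right {T : ℕ} (N : Matrix (Fin T) (Fin T) ℂ) (x y z : Fin T → ℂ) :
    qf N x (y - z) = qf N x y - qf N x z := by
  simp [qf_eq, dotProduct_sub]

lemma qf_add {T : ℕ} (N K : Matrix (Fin T) (Fin T) ℂ) (x y : Fin T → ℂ) :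
    qf (N + K) x y = qf N x y + qf K x y := by
  simp [qf_eq, Matrix.vecMul_add, add_dotProduct]

lemma qf_symm {T : ℕ} {N : Matrix (Fin T) (Fin T) ℂ} (hN : N.IsHermitian) (x y : Fin T → ℂ) :
    (qf N x y).re = (qf N y x).re := by
  have : qf N x y = (starRingEnd ℂ) (qf N y x) := by
    simp only [qf, map_sum, map_mul, Complex.conj_conj]
    rw [Finset.sum_comm]
    refine Finset.sum_congr rfl fun p _ => Finset.sum_congr rfl fun q _ => ?_
    have : (starRingEnd ℂ) (N p q) = N q p := by
      simpa using hN.apply q p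
    rw [this]; ring
  rw [this, Complex.conj_re]

lemma qf_nonneg {T : ℕ} {N : Matrix (Fin T) (Fin T) ℂ} (hN : N.PosSemidef) (x : Fin T → ℂ) :
    0 ≤ (qf N x x) := by
  have := hN.dotProduct_mulVec_nonneg (star x)
  rwa [star_star, ← qf_eq2] at this

lemma qf_re_nonneg {T : ℕ} {N : Matrix (Fin T) (Fin T) ℂ} (hN : N.PosSemidef) (x : Fin T → ℂ) :
    0 ≤ (qf N x x).re := (Complex.le_def.1 (qf_nonneg hN x)).1

section pointwise
variable {T : ℕ} {F G : Matrix (Fin T) (Fin T) ℂ} {A C h : Fin T → ℂ}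

lemma qf_h (hI : IsUnit (F + G))
    (hh : h = Matrix.vecMul A (F * (F + G)⁻¹) - Matrix.vecMul C (F + G)⁻¹)
    (y : Fin T → ℂ) : qf (F + G) h y = qf F A y - C ⬝ᵥ star y := by
  have hd : (F + G)⁻¹ * (F + G) = 1 :=
    Matrix.nonsing_inv_mul _ ((Matrix.isUnit_iff_isUnit_det _).1 hI)
  have : Matrix.vecMul h (F + G) = Matrix.vecMul A F - C := by
    rw [hh, Matrix.sub_vecMul, Matrix.vecMul_vecMul, Matrix.vecMul_vecMul, Matrix.mul_assoc, hd]
    simp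
  rw [qf_eq, this, sub_dotProduct, ← qf_eq]

lemma Q_eq (hF : F.PosSemidef)
    (hI : IsUnit (F + G))
    (hh : h = Matrix.vecMul A (F * (F + G)⁻¹) - Matrix.vecMul C (F + G)⁻¹)
    (g : Fin T → ℂ) :
    (qf F (A - g) (A - g)).re + (qf G g g).re = (qf F A A).re - 2 * (qf (F + G) h g).re
      - 2 * (C ⬝ᵥ star g).re + (qf (F + G) g g).re := by
  have h1 := qf_symm hF.1 A g
  rw [qf_h hI hh, qf_add, qf_sub_left, qf_sub_right, qf_sub_right]
  simp only [Complex.sub_re, Complex.add_re]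
  linarith

lemma Q_diff (hF : F.PosSemidef)
    (hG : G.PosSemidef)
    (hI : IsUnit (F + G))
    (hh : h = Matrix.vecMul A (F * (F + G)⁻¹) - Matrix.vecMul C (F + G)⁻¹)
    (g : Fin T → ℂ) :
    (qf F (A - h) (A - h)).re + (qf G h h).re - 2 * (C ⬝ᵥ star (g - h)).re ≤
    (qf F (A - g) (A - g)).re + (qf G g g).re := by
  have h1 := qf_symm (hF.add hG).1 g h
  have h2 := qf_re_nonneg (hF.add hG) (g - h)
  rw [Q_eq hF hI hh, Q_eq hF hI hh]
  rw [qf_sub_left, qf_sub_right, qf_sub_right] at h2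
  rw [star_sub, dotProduct_sub]
  simp only [Complex.sub_re] at *
  linarith

lemma Q_bound (hF : F.PosSemidef)
    (hG : G.PosSemidef)
    (hI : IsUnit (F + G))
    (hh : h = Matrix.vecMul A (F * (F + G)⁻¹) - Matrix.vecMul C (F + G)⁻¹)
    : (qf F (A - h) (A - h)).re + (qf G h h).re ≤
    (qf F A A).re - 2 * (C ⬝ᵥ star h).re := by
  have h2 := qf_re_nonneg (hF.add hG) h
  rw [Q_eq hF hI hh]
  linarith

lemma FD_bound (hF : F.PosSemidef)
    (hG : G.PosSemidef)
    (hI : IsUnit (F + G))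
    (p q : Fin T) : ‖(F * (F + G)⁻¹) p q‖ ≤ ‖F p p‖ + ‖(F + G)⁻¹ q q‖ := by
  set e : Fin T → ℂ := Pi.single p 1 with he
  set h1 : Fin T → ℂ := Matrix.vecMul e (F * (F + G)⁻¹) with hh1
  have e1 : h1 = Matrix.vecMul e (F * (F + G)⁻¹) - Matrix.vecMul 0 (F + G)⁻¹ := by simp [hh1]
  have hq : (F * (F + G)⁻¹) p q = h1 q := by simp [hh1, he]
  rw [hq]
  obtain ⟨u, hu, hu2⟩ : ∃ u : ℂ, ‖u‖ = 1 ∧ u * (starRingEnd ℂ) (h1 q) = -(‖h1 q‖ : ℂ) := by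
    by_cases h0 : h1 q = 0
    · exact ⟨1, by simp, by simp [h0]⟩
    · refine ⟨-(h1 q / ‖h1 q‖), by simp [h0], ?_⟩
      have : (‖h1 q‖ : ℂ) ≠ 0 := by simpa using h0
      rw [neg_mul, div_mul_eq_mul_div, Complex.mul_conj, Complex.normSq_eq_norm_sq]
      field_simp
      push_cast; ring
  obtain ⟨y, hy⟩ : ∃ y : Fin T → ℂ, y = Matrix.vecMul 0 (F * (F + G)⁻¹) -
    Matrix.vecMul (Pi.single q u) (F + G)⁻¹ := ⟨_, rfl⟩
  have b1 := Q_eq hF hI e1 h1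
  have b2 := qf_re_nonneg hF (e - h1)
  have b3 := qf_re_nonneg hG h1
  have b4 := qf_re_nonneg (hF.add hG) (h1 - y)
  have b5 := qf_symm (hF.add hG).1 h1 y
  have b6 : ∀ x, qf (F + G) y x = -(u * (starRingEnd ℂ) (x q)) := by
    intro x
    rw [qf_h hI hy]
    simp [qf_eq]
  have b7 : (qf F e e) = F p p := by
    simp [qf_eq, he, dotProduct, Pi.single_apply]
  have b8 : y q = - (u * (F + G)⁻¹ q q) := by simp [hy]
  rw [qf_sub_left, qf_sub_right, qf_sub_right] at b4
  simp only [Complex.sub_re] at b4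
  rw [b5, b6, b6, hu2, b8] at b4
  rw [b7] at b1
  have b9 : (-(u * (starRingEnd ℂ) (-(u * (F + G)⁻¹ q q)))).re ≤ ‖(F + G)⁻¹ q q‖ := by
    refine (Complex.re_le_norm _).trans ?_
    simp [hu]
  have b10 := Complex.re_le_norm (F p p)
  have b11 : (-(-(‖h1 q‖ : ℂ))).re = ‖h1 q‖ := by simp
  rw [b11] at b4
  simp only [zero_dotProduct, Complex.zero_re] at b1
  have := norm_nonneg (h1 q)
  have := norm_nonneg (F p p)
  have := norm_nonneg ((F + G)⁻¹ q q)
  linarith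

end pointwise

section series
variable {α : ℤ → ℂ} {e : ℤ → ℝ → ℂ}

lemma ser_summable (hα : Summable fun j => ‖α j‖)
    (heb : ∀ j x, ‖e j x‖ ≤ 1)
    (x : ℝ) : Summable fun j => ‖α j * e j x‖ := by
  refine Summable.of_nonneg_of_le (fun _ => norm_nonneg _) (fun j => ?_) hα
  rw [norm_mul]
  exact mul_le_of_le_one_right (norm_nonneg _) (heb j x)

lemma ser_bound (hα : Summable fun j => ‖α j‖)
    (heb : ∀ j x, ‖e j x‖ ≤ 1)
    (x : ℝ) : ‖∑' j, α j * e j x‖ ≤ ∑' j, ‖α j‖ := by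
  refine tsum_of_norm_bounded hα.hasSum (fun j => ?_)
  rw [norm_mul]
  exact mul_le_of_le_one_right (norm_nonneg _) (heb j x)

lemma ser_cont (hα : Summable fun j => ‖α j‖)
    (hec : ∀ j, Continuous (e j))
    (heb : ∀ j x, ‖e j x‖ ≤ 1)
    : Continuous fun x => ∑' j, α j * e j x := by
  refine continuous_tsum (fun j => continuous_const.mul (hec j)) hα (fun j x => ?_)
  rw [norm_mul]
  exact mul_le_of_le_one_right (norm_nonneg _) (heb j x)

lemma ser_hasSum (hα : Summable fun j => ‖α j‖)
    (hec : ∀ j, Continuous (e j))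
    (heb : ∀ j x, ‖e j x‖ ≤ 1)
    {μ : Measure ℝ} {w : ℝ → ℂ} (hw : Integrable w μ) :
    HasSum (fun j => α j * ∫ x, e j x * w x ∂μ) (∫ x, (∑' j, α j * e j x) * w x ∂μ) := by
  have key := hasSum_integral_of_summable_integral_norm (μ := μ)
    (F := fun j x => (α j * e j x) * w x)
    (fun j => by
      refine hw.bdd_mul (c := ‖α j‖) (continuous_const.mul (hec j)).aestronglyMeasurable
        (Filter.Eventually.of_forall fun x => ?_)
      rw [norm_mul]
      exact mul_le_of_le_one_right (norm_nonneg _) (heb j x))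
    (by
      refine Summable.of_nonneg_of_le (fun j => integral_nonneg fun _ => norm_nonneg _)
        (fun j => ?_) (hα.mul_right (∫ x, ‖w x‖ ∂μ))
      rw [← integral_const_mul]
      refine integral_mono_of_nonneg (Filter.Eventually.of_forall fun _ => norm_nonneg _)
        (hw.norm.const_mul _) (Filter.Eventually.of_forall fun x => ?_)
      simp only [norm_mul]
      gcongr
      exact mul_le_of_le_one_right (norm_nonneg _) (heb j x))
  have e1 : (fun j => α j * ∫ x, e j x * w x ∂μ) = fun j => ∫ x, (α j * e j x) * w x ∂μ := by
    funext j
    rw [← integral_const_mul]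
    simp only [mul_assoc]
  have e2 : (∫ x, (∑' j, α j * e j x) * w x ∂μ) = ∫ x, ∑' j, (α j * e j x) * w x ∂μ := by
    simp only [tsum_mul_right]
  rw [e1, e2]
  exact key

end series

lemma exp_cont (z : ℂ) : Continuous fun x : ℝ => Complex.exp (Complex.I * z * (x : ℂ)) := by
  fun_prop

lemma exp_cont' (z : ℂ) : Continuous fun x : ℝ => Complex.exp (-(Complex.I * z * (x : ℂ))) := by
  fun_prop

lemma exp_nrm (n : ℤ) (x : ℝ) : ‖Complex.exp (Complex.I * (n : ℂ) * (x : ℂ))‖ = 1 := by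
  rw [Complex.norm_exp]; simp

lemma exp_nrm' (n : ℤ) (x : ℝ) : ‖Complex.exp (-(Complex.I * (n : ℂ) * (x : ℂ)))‖ = 1 := by
  rw [Complex.norm_exp]; simp

lemma exp_conj (n : ℤ) (x : ℝ) : (starRingEnd ℂ) (Complex.exp (-(Complex.I * (n : ℂ) * (x : ℂ))))
    = Complex.exp (Complex.I * (n : ℂ) * (x : ℂ)) := by
  rw [← Complex.exp_conj]; simp

lemma exp_orth (n : ℤ) (hn : n ≠ 0) :
    ∫ x in (-Real.pi)..Real.pi, Complex.exp (Complex.I * (n : ℂ) * (x : ℂ)) = 0 := by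
  have hc : Complex.I * (n : ℂ) ≠ 0 := by simp [hn]
  rw [integral_exp_mul_complex hc]
  have : Complex.exp (Complex.I * n * (Real.pi : ℝ)) =
      Complex.exp (Complex.I * n * ((-Real.pi : ℝ) : ℂ)) := by
    rw [Complex.exp_eq_exp_iff_exists_int]
    exact ⟨n, by push_cast; ring⟩
  rw [this]; simp

lemma integrable_of_bdd_cont {μ : Measure ℝ} {f w : ℝ → ℂ} (hw : Integrable w μ)
    (hf : Continuous f) (K : ℝ) (hK : ∀ x, ‖f x‖ ≤ K) : Integrable (fun x => f x * w x) μ :=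
  hw.bdd_mul (c := K) hf.aestronglyMeasurable (Filter.Eventually.of_forall hK)

lemma qf_integrable {T : ℕ} {μ : Measure ℝ} {N : ℝ → Matrix (Fin T) (Fin T) ℂ}
    (hN : ∀ p q, Integrable (fun x => N x p q) μ) {f : ℝ → Fin T → ℂ}
    (hf : ∀ p, Continuous fun x => f x p) (K : Fin T → ℝ) (hK : ∀ p x, ‖f x p‖ ≤ K p) :
    Integrable (fun x => qf (N x) (f x) (f x)) μ := by
  unfold qf
  refine integrable_finsetSum _ fun p _ => integrable_finsetSum _ fun q _ => ?_
  have h1 := integrable_of_bdd_cont (hN p q) (hf p) _ (hK p)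
  have h2 := integrable_of_bdd_cont h1 (f := fun x => (starRingEnd ℂ) (f x q))
    (Complex.continuous_conj.comp (hf q)) (K q) (fun x => by simpa using hK q x)
  simpa only [mul_comm] using h2

/-- Theorem 1, spectral-domain form: if the coefficients `c` solve the
normal system `Σ_j a(j)ᵀ R(k,j) = Σ_j c(j)ᵀ B(k,j)`, `k ∈ U`, then the spectral
characteristic `h` has vanishing Fourier coefficients on `U` and gives the
mean-square optimal linear filter among all finite linear combinations of the
observed exponentials `e^{inλ}`, `n ∈ Z₋ ∖ S`, and its error `Δ(h;F,G)` is finite. -/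
theorem stmt_2
    (T s : ℕ) (hT : 1 ≤ T) (hs : 1 ≤ s)
    (Mb Nb : ℕ → ℕ) (hM1 : 0 < Mb 1)
    (hMN : ∀ l, 1 ≤ l → l < s → Mb l + Nb l < Mb (l + 1))
    (S U ZS Zneg : Set ℤ)
    (hS : S = ⋃ l ∈ Finset.Icc 1 s, Set.Icc (-((Mb l : ℤ) + (Nb l : ℤ))) (-(Mb l : ℤ)))
    (hU : U = S ∪ {j : ℤ | 0 ≤ j})
    (hZS : ZS = {j : ℤ | 1 ≤ j} \ {j : ℤ | -j ∈ S})
    (hZneg : Zneg = {j : ℤ | j < 0})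
    (F G : ℝ → Matrix (Fin T) (Fin T) ℂ)
    (hFmeas : ∀ p q, Measurable fun x => F x p q)
    (hGmeas : ∀ p q, Measurable fun x => G x p q)
    (hFpsd : ∀ᵐ x : ℝ, x ∈ Set.Icc (-Real.pi) Real.pi → (F x).PosSemidef)
    (hGpsd : ∀ᵐ x : ℝ, x ∈ Set.Icc (-Real.pi) Real.pi → (G x).PosSemidef)
    (hFint : ∀ p q, IntervalIntegrable (fun x => F x p q) volume (-Real.pi) Real.pi)
    (hGint : ∀ p q, IntervalIntegrable (fun x => G x p q) volume (-Real.pi) Real.pi)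
    (hinv : ∀ᵐ x : ℝ, x ∈ Set.Icc (-Real.pi) Real.pi → IsUnit (F x + G x))
    (hmin : ∀ p q, IntervalIntegrable (fun x => (F x + G x)⁻¹ p q) volume (-Real.pi) Real.pi)
    (a : ℤ → Fin T → ℂ) (ha0 : ∀ j, j ∉ ZS → a j = 0)
    (haSum : Summable fun j : ℤ => ∑ k, ‖a j k‖)
    (A : ℝ → Fin T → ℂ)
    (hA : ∀ x k, A x k = ∑' j : ℤ, a j k * Complex.exp (-(Complex.I * (j : ℂ) * (x : ℂ))))
    (c : ℤ → Fin T → ℂ) (hc0 : ∀ j, j ∉ U → c j = 0)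
    (hcSum : Summable fun j : ℤ => ∑ k, ‖c j k‖)
    (Cf : ℝ → Fin T → ℂ)
    (hCf : ∀ x k, Cf x k = ∑' j : ℤ, c j k * Complex.exp (Complex.I * (j : ℂ) * (x : ℂ)))
    (h : ℝ → Fin T → ℂ)
    (hh : ∀ x, h x = Matrix.vecMul (A x) (F x * (F x + G x)⁻¹) -
      Matrix.vecMul (Cf x) (F x + G x)⁻¹)
    (B R : ℤ → ℤ → Matrix (Fin T) (Fin T) ℂ)
    (hB : ∀ k j p q, B k j p q = (1 / (2 * (Real.pi : ℂ))) *
      ∫ x in (-Real.pi)..Real.pi,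
        (F x + G x)⁻¹ p q * Complex.exp (-(Complex.I * ((k : ℂ) - (j : ℂ)) * (x : ℂ))))
    (hR : ∀ k j p q, R k j p q = (1 / (2 * (Real.pi : ℂ))) *
      ∫ x in (-Real.pi)..Real.pi,
        (F x * (F x + G x)⁻¹) p q * Complex.exp (-(Complex.I * ((k : ℂ) + (j : ℂ)) * (x : ℂ))))
    (Δ : (ℝ → Fin T → ℂ) → ℂ)
    (hΔ : ∀ g : ℝ → Fin T → ℂ, Δ g =
      (1 / (2 * (Real.pi : ℂ))) * (∫ x in (-Real.pi)..Real.pi,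
        ∑ p, ∑ q, (A x p - g x p) * F x p q * (starRingEnd ℂ) (A x q - g x q)) +
      (1 / (2 * (Real.pi : ℂ))) * (∫ x in (-Real.pi)..Real.pi,
        ∑ p, ∑ q, g x p * G x p q * (starRingEnd ℂ) (g x q)))
    (hnormal : ∀ k ∈ U,
      (∑' j : ℤ, Matrix.vecMul (a j) (R k j)) = ∑' j : ℤ, Matrix.vecMul (c j) (B k j)) :
    (∀ k ∈ U, ∀ q, (1 / (2 * (Real.pi : ℂ))) *
        (∫ x in (-Real.pi)..Real.pi,
          h x q * Complex.exp (-(Complex.I * (k : ℂ) * (x : ℂ)))) = 0) ∧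
    (IntervalIntegrable (fun x => ∑ p, ∑ q,
        (A x p - h x p) * F x p q * (starRingEnd ℂ) (A x q - h x q))
        volume (-Real.pi) Real.pi ∧
     IntervalIntegrable (fun x => ∑ p, ∑ q, h x p * G x p q * (starRingEnd ℂ) (h x q))
        volume (-Real.pi) Real.pi) ∧
    (∀ b : ℤ → Fin T → ℂ, (Function.support b).Finite →
      (∀ n : ℤ, b n ≠ 0 → n ∈ Zneg \ S) →
      (Δ h).re ≤
        (Δ (fun x k => ∑' n : ℤ, b n k * Complex.exp (Complex.I * (n : ℂ) * (x : ℂ)))).re) := by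

  have hle : (-Real.pi) ≤ Real.pi := by linarith [Real.pi_pos]
  simp only [intervalIntegrable_iff_integrableOn_Ioc_of_le hle, IntegrableOn] at hFint hGint hmin ⊢
  simp only [intervalIntegral.integral_of_le hle] at hB hR hΔ ⊢
  set μ : Measure ℝ := volume.restrict (Set.Ioc (-Real.pi) Real.pi) with hμ
  have hae : ∀ {P : ℝ → Prop}, (∀ᵐ x : ℝ, x ∈ Set.Icc (-Real.pi) Real.pi → P x) → ∀ᵐ x ∂μ, P x := by
    intro P hP
    rw [hμ, ae_restrict_iff' measurableSet_Ioc]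
    filter_upwards [hP] with x hx h2
    exact hx ⟨h2.1.le, h2.2⟩
  have hFp := hae hFpsd
  have hGp := hae hGpsd
  have hI := hae hinv
  -- summability of the components
  have hcomp : ∀ {d : ℤ → Fin T → ℂ}, (Summable fun j : ℤ => ∑ k, ‖d j k‖) →
      ∀ k, Summable fun j => ‖d j k‖ := by
    intro d hd k
    refine Summable.of_nonneg_of_le (fun _ => norm_nonneg _) (fun j => ?_) hd
    exact Finset.single_le_sum (f := fun k => ‖d j k‖) (fun _ _ => norm_nonneg _)
      (Finset.mem_univ k)
  have haS := hcomp haSum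
  have hcS := hcomp hcSum
  have hAfun : ∀ k, (fun x => A x k) = fun x : ℝ => ∑' j : ℤ, a j k *
      Complex.exp (-(Complex.I * (j : ℂ) * (x : ℂ))) := fun k => funext fun x => hA x k
  have hCfun : ∀ k, (fun x => Cf x k) = fun x : ℝ => ∑' j : ℤ, c j k *
      Complex.exp (Complex.I * (j : ℂ) * (x : ℂ)) := fun k => funext fun x => hCf x k
  have en1 : ∀ (j : ℤ) (x : ℝ), ‖Complex.exp (Complex.I * (j : ℂ) * (x : ℂ))‖ ≤ 1 :=
    fun j x => (exp_nrm j x).le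
  have en2 : ∀ (j : ℤ) (x : ℝ), ‖Complex.exp (-(Complex.I * (j : ℂ) * (x : ℂ)))‖ ≤ 1 :=
    fun j x => (exp_nrm' j x).le
  have ec1 := fun j : ℤ => exp_cont (j : ℂ)
  have ec2 := fun j : ℤ => exp_cont' (j : ℂ)
  have hAc : ∀ k, Continuous fun x => A x k := fun k => by
    rw [hAfun k]; exact ser_cont (haS k) ec2 en2
  have hCc : ∀ k, Continuous fun x => Cf x k := fun k => by
    rw [hCfun k]; exact ser_cont (hcS k) ec1 en1
  have hAb : ∀ k x, ‖A x k‖ ≤ ∑' j, ‖a j k‖ := fun k x => by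
    rw [hA x k]; exact ser_bound (haS k) en2 x
  have hCb : ∀ k x, ‖Cf x k‖ ≤ ∑' j, ‖c j k‖ := fun k x => by
    rw [hCf x k]; exact ser_bound (hcS k) en1 x
  -- integrability of F (F+G)⁻¹
  have hFD : ∀ p q, Integrable (fun x => (F x * (F x + G x)⁻¹) p q) μ := by
    intro p q
    refine Integrable.mono' ((hFint p p).norm.add (hmin q q).norm) ?_ ?_
    · simp only [Matrix.mul_apply]
      refine Finset.aestronglyMeasurable_fun_sum _ fun i _ => ?_
      exact (hFint p i).aestronglyMeasurable.mul (hmin i q).aestronglyMeasurable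
    · filter_upwards [hFp, hGp, hI] with x h1 h2 h3
      exact FD_bound h1 h2 h3 p q
  have hhq : ∀ x q, h x q = ∑ p, A x p * (F x * (F x + G x)⁻¹) p q -
      ∑ p, Cf x p * (F x + G x)⁻¹ p q := by
    intro x q
    rw [hh x]
    simp [Matrix.vecMul, dotProduct]
  have hAFD : ∀ p q, Integrable (fun x => A x p * (F x * (F x + G x)⁻¹) p q) μ := fun p q =>
    integrable_of_bdd_cont (hFD p q) (hAc p) _ (hAb p)
  have hCD : ∀ p q, Integrable (fun x => Cf x p * (F x + G x)⁻¹ p q) μ := fun p q =>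
    integrable_of_bdd_cont (hmin p q) (hCc p) _ (hCb p)
  have hhint : ∀ q, Integrable (fun x => h x q) μ := by
    intro q
    simp only [hhq]
    exact (integrable_finsetSum _ fun p _ => hAFD p q).sub (integrable_finsetSum _ fun p _ => hCD p q)
  -- part (i)
  have part1 : ∀ k ∈ U, ∀ q, ∫ x, h x q * Complex.exp (-(Complex.I * (k : ℂ) * (x : ℂ))) ∂μ = 0 := by
    intro k hk
    have hw1 : ∀ p q, Integrable (fun x : ℝ => Complex.exp (-(Complex.I * (k : ℂ) * (x : ℂ))) *
        (F x * (F x + G x)⁻¹) p q) μ := fun p q =>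
      integrable_of_bdd_cont (hFD p q) (ec2 k) 1 (en2 k)
    have hw2 : ∀ p q, Integrable (fun x : ℝ => Complex.exp (-(Complex.I * (k : ℂ) * (x : ℂ))) *
        (F x + G x)⁻¹ p q) μ := fun p q =>
      integrable_of_bdd_cont (hmin p q) (ec2 k) 1 (en2 k)
    have s1 := fun p q => ser_hasSum (haS p) ec2 en2 (hw1 p q)
    have s2 := fun p q => ser_hasSum (hcS p) ec1 en1 (hw2 p q)
    simp only [← hA] at s1
    simp only [← hCf] at s2
    have hpi : (2 * (Real.pi : ℂ)) ≠ 0 := by simp [Real.pi_ne_zero]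
    have r1 : ∀ (j : ℤ) p q, ∫ x : ℝ, Complex.exp (-(Complex.I * (j : ℂ) * (x : ℂ))) *
        (Complex.exp (-(Complex.I * (k : ℂ) * (x : ℂ))) * (F x * (F x + G x)⁻¹) p q) ∂μ
        = (2 * (Real.pi : ℂ)) * R k j p q := by
      intro j p q
      rw [hR, ← mul_assoc, mul_one_div_cancel hpi, one_mul]
      refine integral_congr_ae (Filter.Eventually.of_forall fun x => ?_)
      simp only
      rw [← mul_assoc, ← Complex.exp_add, mul_comm]
      congr 2
      ring
    have r2 : ∀ (j : ℤ) p q, ∫ x : ℝ, Complex.exp (Complex.I * (j : ℂ) * (x : ℂ)) *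
        (Complex.exp (-(Complex.I * (k : ℂ) * (x : ℂ))) * (F x + G x)⁻¹ p q) ∂μ
        = (2 * (Real.pi : ℂ)) * B k j p q := by
      intro j p q
      rw [hB, ← mul_assoc, mul_one_div_cancel hpi, one_mul]
      refine integral_congr_ae (Filter.Eventually.of_forall fun x => ?_)
      simp only
      rw [← mul_assoc, ← Complex.exp_add, mul_comm]
      congr 2
      ring
    simp only [r1] at s1
    simp only [r2] at s2
    have v1 : HasSum (fun j => (2 * (Real.pi : ℂ)) • Matrix.vecMul (a j) (R k j))
        (fun q => ∑ p, ∫ x : ℝ, A x p * (Complex.exp (-(Complex.I * (k : ℂ) * (x : ℂ))) *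
          (F x * (F x + G x)⁻¹) p q) ∂μ) := by
      rw [Pi.hasSum]
      intro q
      have := hasSum_sum (s := Finset.univ) fun p _ => s1 p q
      convert this using 2 with j
      simp only [Pi.smul_apply, Matrix.vecMul, dotProduct, smul_eq_mul, Finset.mul_sum]
      exact Finset.sum_congr rfl fun p _ => by ring
    have v2 : HasSum (fun j => (2 * (Real.pi : ℂ)) • Matrix.vecMul (c j) (B k j))
        (fun q => ∑ p, ∫ x : ℝ, Cf x p * (Complex.exp (-(Complex.I * (k : ℂ) * (x : ℂ))) *
          (F x + G x)⁻¹ p q) ∂μ) := by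
      rw [Pi.hasSum]
      intro q
      have := hasSum_sum (s := Finset.univ) fun p _ => s2 p q
      convert this using 2 with j
      simp only [Pi.smul_apply, Matrix.vecMul, dotProduct, smul_eq_mul, Finset.mul_sum]
      exact Finset.sum_congr rfl fun p _ => by ring
    intro q
    have hEq := congrFun (v1.tsum_eq.symm.trans (by
      rw [tsum_const_smul'', hnormal k hk, ← tsum_const_smul'', v2.tsum_eq])) q
    have i1 : ∀ p, Integrable (fun x : ℝ => A x p * (Complex.exp (-(Complex.I * (k : ℂ) * (x : ℂ))) *
          (F x * (F x + G x)⁻¹) p q)) μ := fun p =>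
      integrable_of_bdd_cont (hw1 p q) (hAc p) _ (hAb p)
    have i2 : ∀ p, Integrable (fun x : ℝ => Cf x p * (Complex.exp (-(Complex.I * (k : ℂ) * (x : ℂ))) *
          (F x + G x)⁻¹ p q)) μ := fun p =>
      integrable_of_bdd_cont (hw2 p q) (hCc p) _ (hCb p)
    rw [← integral_finsetSum _ fun p _ => i1 p, ← integral_finsetSum _ fun p _ => i2 p,
      ← sub_eq_zero, ← integral_sub (integrable_finsetSum _ fun p _ => i1 p)
        (integrable_finsetSum _ fun p _ => i2 p)] at hEq
    rw [← hEq]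
    refine integral_congr_ae (Filter.Eventually.of_forall fun x => ?_)
    simp only [hhq, sub_mul, Finset.sum_mul]
    congr 1 <;> exact Finset.sum_congr rfl fun p _ => by ring
  refine ⟨fun k hk q => by rw [part1 k hk q, mul_zero], ?_⟩
  -- orthogonality to C
  have orth : ∀ (w : ℝ → ℂ), Integrable w μ →
      (∀ k ∈ U, ∫ x, w x * Complex.exp (-(Complex.I * (k : ℂ) * (x : ℂ))) ∂μ = 0) →
      ∀ q, ∫ x, Cf x q * (starRingEnd ℂ) (w x) ∂μ = 0 := by
    intro w hw hw0 q
    have hw' : Integrable (fun x => (starRingEnd ℂ) (w x)) μ :=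
      (Complex.conjCLE.toContinuousLinearMap.integrable_comp hw)
    have s := ser_hasSum (hcS q) ec1 en1 hw'
    simp only [← hCf] at s
    rw [← s.tsum_eq]
    refine (tsum_congr fun j => ?_).trans tsum_zero
    by_cases hj : j ∈ U
    · have : ∫ x : ℝ, Complex.exp (Complex.I * (j : ℂ) * (x : ℂ)) * (starRingEnd ℂ) (w x) ∂μ =
          (starRingEnd ℂ) (∫ x, w x * Complex.exp (-(Complex.I * (j : ℂ) * (x : ℂ))) ∂μ) := by
        rw [← integral_conj]
        refine integral_congr_ae (Filter.Eventually.of_forall fun x => ?_)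
        simp only [map_mul, exp_conj]
        ring
      rw [this, hw0 j hj]; simp
    · simp [hc0 j hj]
  have hCconj : ∀ {v : ℝ → Fin T → ℂ}, (∀ q, Integrable (fun x => v x q) μ) →
      ∀ q, Integrable (fun x => Cf x q * (starRingEnd ℂ) (v x q)) μ := by
    intro v hv q
    exact integrable_of_bdd_cont (Complex.conjCLE.toContinuousLinearMap.integrable_comp (hv q))
      (hCc q) _ (hCb q)
  have hCdot : ∀ {v : ℝ → Fin T → ℂ}, (∀ q, Integrable (fun x => v x q) μ) →
      Integrable (fun x => Cf x ⬝ᵥ star (v x)) μ := by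
    intro v hv
    exact integrable_finsetSum _ fun q _ => hCconj hv q
  -- integrability
  have hQA := qf_integrable hFint hAc _ hAb
  have hbd : Integrable (fun x => (qf (F x) (A x) (A x)).re - 2 * (Cf x ⬝ᵥ star (h x)).re) μ :=
    hQA.re.sub ((hCdot hhint).re.const_mul 2)
  have hFh : Integrable (fun x => qf (F x) (A x - h x) (A x - h x)) μ := by
    refine Integrable.mono' hbd ?_ ?_
    · unfold qf
      refine Finset.aestronglyMeasurable_fun_sum _ fun p _ =>
        Finset.aestronglyMeasurable_fun_sum _ fun q _ => ?_
      have m : ∀ p, AEStronglyMeasurable (fun x => (A x - h x) p) μ := fun p =>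
        (hAc p).aestronglyMeasurable.sub (hhint p).aestronglyMeasurable
      exact ((m p).mul (hFint p q).aestronglyMeasurable).mul
        (Complex.continuous_conj.comp_aestronglyMeasurable (m q))
    · filter_upwards [hFp, hGp, hI] with x h1 h2 h3
      have b := Q_bound h1 h2 h3 (hh x)
      have := qf_re_nonneg h2 (h x)
      rw [← Complex.re_eq_norm.2 (qf_nonneg h1 _)]
      linarith
  have hGh : Integrable (fun x => qf (G x) (h x) (h x)) μ := by
    refine Integrable.mono' hbd ?_ ?_
    · unfold qf
      refine Finset.aestronglyMeasurable_fun_sum _ fun p _ =>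
        Finset.aestronglyMeasurable_fun_sum _ fun q _ => ?_
      exact ((hhint p).aestronglyMeasurable.mul (hGint p q).aestronglyMeasurable).mul
        (Complex.continuous_conj.comp_aestronglyMeasurable (hhint q).aestronglyMeasurable)
    · filter_upwards [hFp, hGp, hI] with x h1 h2 h3
      have b := Q_bound h1 h2 h3 (hh x)
      have := qf_re_nonneg h1 (A x - h x)
      rw [← Complex.re_eq_norm.2 (qf_nonneg h2 _)]
      linarith
  refine ⟨⟨hFh, hGh⟩, ?_⟩
  intro b hbfin hbsup
  set g : ℝ → Fin T → ℂ := fun x k => ∑' n : ℤ, b n k * Complex.exp (Complex.I * (n : ℂ) * (x : ℂ))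
    with hg
  have hbS : ∀ k, Summable fun n => ‖b n k‖ := by
    intro k
    refine summable_of_hasFiniteSupport (hbfin.subset fun n hn => ?_)
    simp only [Function.mem_support] at hn ⊢
    intro h0
    apply hn
    simp [h0]
  have hgc : ∀ k, Continuous fun x => g x k := fun k => ser_cont (hbS k) ec1 en1
  have hgb : ∀ k x, ‖g x k‖ ≤ ∑' j, ‖b j k‖ := fun k x => ser_bound (hbS k) en1 x
  have hone : Integrable (fun _ : ℝ => (1 : ℂ)) μ := by
    rw [hμ]; exact integrable_const _
  have hgint : ∀ k, Integrable (fun x => g x k) μ := fun k => by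
    simpa using integrable_of_bdd_cont hone (hgc k) _ (hgb k)
  have hg0 : ∀ k ∈ U, ∀ q, ∫ x, g x q * Complex.exp (-(Complex.I * (k : ℂ) * (x : ℂ))) ∂μ = 0 := by
    intro k hk q
    have hw : Integrable (fun x : ℝ => Complex.exp (-(Complex.I * (k : ℂ) * (x : ℂ)))) μ := by
      simpa using integrable_of_bdd_cont hone (ec2 k) 1 (en2 k)
    have s := ser_hasSum (hbS q) ec1 en1 hw
    have e : ∀ x q, g x q = ∑' n : ℤ, b n q * Complex.exp (Complex.I * (n : ℂ) * (x : ℂ)) :=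
      fun _ _ => rfl
    simp only [e]
    rw [← s.tsum_eq]
    refine (tsum_congr fun j => ?_).trans tsum_zero
    by_cases hj : b j = 0
    · simp [hj]
    · have h1 := hbsup j hj
      have hne : j - k ≠ 0 := by
        intro h0
        have : j = k := by omega
        subst this
        rw [hU] at hk
        rw [hZneg] at h1
        rcases hk with hk | hk
        · exact h1.2 hk
        · have h3 : j < 0 := h1.1
          have h4 : 0 ≤ j := hk
          omega
      have := exp_orth (j - k) hne
      rw [intervalIntegral.integral_of_le hle] at this
      rw [show (∫ x : ℝ, Complex.exp (Complex.I * (j : ℂ) * (x : ℂ)) *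
        Complex.exp (-(Complex.I * (k : ℂ) * (x : ℂ))) ∂μ) = 0 from ?_, mul_zero]
      rw [← this]
      refine integral_congr_ae (Filter.Eventually.of_forall fun x => ?_)
      simp only
      rw [← Complex.exp_add]
      congr 1
      push_cast
      ring
  have hd0 : ∫ x, (Cf x ⬝ᵥ star (g x - h x)) ∂μ = 0 := by
    have hdint : ∀ q, Integrable (fun x => (g x - h x) q) μ := fun q => (hgint q).sub (hhint q)
    have : ∀ x, Cf x ⬝ᵥ star (g x - h x) =
      ∑ q, Cf x q * (starRingEnd ℂ) ((g x - h x) q) := fun x => rfl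
    simp only [this]
    rw [integral_finsetSum _ fun q _ => hCconj hdint q]
    refine Finset.sum_eq_zero fun q _ => ?_
    refine orth (fun x => (g x - h x) q) (hdint q) (fun k hk => ?_) q
    simp only [Pi.sub_apply, sub_mul]
    have mulE : ∀ {w : ℝ → ℂ}, Integrable w μ →
        Integrable (fun x : ℝ => w x * Complex.exp (-(Complex.I * (k : ℂ) * (x : ℂ)))) μ := by
      intro w hw
      simpa only [mul_comm] using integrable_of_bdd_cont hw (ec2 k) 1 (en2 k)
    rw [integral_sub (mulE (hgint q)) (mulE (hhint q)), hg0 k hk, part1 k hk, sub_zero]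
  have hFg : Integrable (fun x => qf (F x) (A x - g x) (A x - g x)) μ := by
    refine qf_integrable (f := fun x => A x - g x) hFint (fun p => (hAc p).sub (hgc p))
      (fun p => (∑' j, ‖a j p‖) + ∑' j, ‖b j p‖) (fun p x => ?_)
    exact (norm_sub_le _ _).trans (add_le_add (hAb p x) (hgb p x))
  have hGg : Integrable (fun x => qf (G x) (g x) (g x)) μ := qf_integrable hGint hgc _ hgb
  have hΔ' : ∀ f : ℝ → Fin T → ℂ, Integrable (fun x => qf (F x) (A x - f x) (A x - f x)) μ →
      Integrable (fun x => qf (G x) (f x) (f x)) μ →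
      (Δ f).re = (1 / (2 * Real.pi)) *
        ∫ x, ((qf (F x) (A x - f x) (A x - f x)).re + (qf (G x) (f x) (f x)).re) ∂μ := by
    intro f h1 h2
    have e : Δ f = ((1 / (2 * Real.pi) : ℝ) : ℂ) * ((∫ x, qf (F x) (A x - f x) (A x - f x) ∂μ) +
        ∫ x, qf (G x) (f x) (f x) ∂μ) := by
      rw [hΔ f, mul_add]
      push_cast
      rfl
    rw [e, Complex.re_ofReal_mul, Complex.add_re]
    congr 1
    have r1 := integral_re h1
    have r2 := integral_re h2
    simp only [RCLike.re_to_complex] at r1 r2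
    have r3 := integral_add h1.re h2.re
    simp only [RCLike.re_to_complex] at r3
    rw [r3, r1, r2]
  rw [hΔ' h hFh hGh, hΔ' g hFg hGg]
  refine mul_le_mul_of_nonneg_left ?_ (by positivity)
  have hdd : Integrable (fun x => Cf x ⬝ᵥ star (g x - h x)) μ :=
    hCdot (v := fun x => g x - h x) fun q => (hgint q).sub (hhint q)
  have hz : ∫ x, 2 * (Cf x ⬝ᵥ star (g x - h x)).re ∂μ = 0 := by
    rw [integral_const_mul]
    have r := integral_re hdd
    simp only [RCLike.re_to_complex] at r
    rw [r, hd0]; simp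
  have hi1 : Integrable (fun x => (qf (F x) (A x - h x) (A x - h x)).re + (qf (G x) (h x) (h x)).re) μ :=
    hFh.re.add hGh.re
  have hi2 : Integrable (fun x => 2 * (Cf x ⬝ᵥ star (g x - h x)).re) μ := hdd.re.const_mul 2
  have hi3 : Integrable (fun x => (qf (F x) (A x - g x) (A x - g x)).re + (qf (G x) (g x) (g x)).re) μ :=
    hFg.re.add hGg.re
  rw [← sub_zero (∫ x, ((qf (F x) (A x - h x) (A x - h x)).re + (qf (G x) (h x) (h x)).re) ∂μ),
    ← hz, ← integral_sub hi1 hi2]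
  refine integral_mono_ae (hi1.sub hi2) hi3 ?_
  filter_upwards [hFp, hGp, hI] with x h1 h2 h3
  exact Q_diff h1 h2 h3 (hh x) (g x)
end

section
/- Assume the setup below (no condition relating a and c is required). Then the mean-square error of the estimate with spectral characteristic h satisfies Δ(h;F,G) = (1/2π)∫_{−π}^{π} A(λ)^⊤ F(λ)(F(λ)+G(λ))⁻¹ G(λ) conj(A(λ)) dλ + (1/2π)∫_{−π}^{π} C(λ)^⊤ (F(λ)+G(λ))⁻¹ conj(C(λ)) dλ, all integrals being finite. -/
open MeasureTheory
open scoped ComplexOrder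

lemma aux_quad {T : ℕ} (x y : Fin T → ℂ) (N : Matrix (Fin T) (Fin T) ℂ) :
    ∑ p, ∑ q, x p * N p q * (starRingEnd ℂ) (y q) = dotProduct x (Matrix.mulVec N (star y)) := by
  simp only [dotProduct, Matrix.mulVec, Finset.mul_sum, mul_assoc]
  rfl

lemma aux_nonneg {T : ℕ} (x : Fin T → ℂ) {N : Matrix (Fin T) (Fin T) ℂ} (hN : N.PosSemidef) :
    0 ≤ ∑ p, ∑ q, x p * N p q * (starRingEnd ℂ) (x q) := by
  rw [aux_quad]
  simpa using hN.dotProduct_mulVec_nonneg (star x)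

lemma aux_comm {T : ℕ} {F G Q : Matrix (Fin T) (Fin T) ℂ}
    (h1 : (F + G) * Q = 1) (h2 : Q * (F + G) = 1) : F * Q * G = G * Q * F := by
  have e1 : F * Q = 1 - G * Q := by rw [← h1]; noncomm_ring
  have e2 : Q * G = 1 - Q * F := by rw [← h2]; noncomm_ring
  have e3 : F * Q * F + G * Q * F = F := by
    rw [← add_mul, ← add_mul, h1, one_mul]
  have : F * Q * G = F - F * Q * F := by rw [mul_assoc, e2]; noncomm_ring
  rw [this]; nth_rewrite 1 [← e3]; noncomm_ring

lemma aux_X {T : ℕ} {F G Q : Matrix (Fin T) (Fin T) ℂ}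
    (h1 : (F + G) * Q = 1) (h2 : Q * (F + G) = 1) :
    G * Q * F * Q * G + F * Q * G * Q * F = F * Q * G := by
  have hc := aux_comm h1 h2
  calc _ = (F * Q * G) * (Q * (F + G)) := by rw [← hc]; noncomm_ring
    _ = _ := by rw [h2, mul_one]

lemma aux_Y {T : ℕ} {F G Q : Matrix (Fin T) (Fin T) ℂ}
    (h1 : (F + G) * Q = 1) (h2 : Q * (F + G) = 1) :
    F * Q * G + G * Q * G = G := by
  rw [← add_mul, ← add_mul, h1, one_mul]

lemma aux_key {T : ℕ} {F G Q : Matrix (Fin T) (Fin T) ℂ} (hF : F.IsHermitian)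
    (hG : G.IsHermitian) (hQ : Q.IsHermitian)
    (h1 : (F + G) * Q = 1) (h2 : Q * (F + G) = 1) (A C h : Fin T → ℂ)
    (hh : h = Matrix.vecMul A (F * Q) - Matrix.vecMul C Q) :
    (∑ p, ∑ q, (A p - h p) * F p q * (starRingEnd ℂ) (A q - h q)) +
      (∑ p, ∑ q, h p * G p q * (starRingEnd ℂ) (h q)) =
    (∑ p, ∑ q, A p * (F * Q * G) p q * (starRingEnd ℂ) (A q)) +
      (∑ p, ∑ q, C p * Q p q * (starRingEnd ℂ) (C q)) := by
  have hk : A - h = Matrix.vecMul A (G * Q) + Matrix.vecMul C Q := by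
    have : A = Matrix.vecMul A (F * Q) + Matrix.vecMul A (G * Q) := by
      rw [← Matrix.vecMul_add, ← add_mul, h1, Matrix.vecMul_one]
    nth_rewrite 1 [this]; rw [hh]; abel
  have e := aux_quad (A - h) (A - h) F
  simp only [Pi.sub_apply] at e
  rw [e, aux_quad, aux_quad, aux_quad, hk, hh]
  have sA (M : Matrix (Fin T) (Fin T) ℂ) (v : Fin T → ℂ) :
      star (Matrix.vecMul v M) = Matrix.mulVec M.conjTranspose (star v) := by
    rw [Matrix.star_vecMul]
  have hc := aux_comm h1 h2
  have hX := aux_X h1 h2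
  have hQQ : Q * F * Q + Q * G * Q = Q := by rw [← add_mul, ← mul_add, h2, one_mul]
  have c1 : G * Q * F * Q = F * Q * G * Q := by rw [hc]
  have c2 : Q * F * Q * G = Q * G * Q * F := by
    simp only [mul_assoc] at hc ⊢; rw [hc]
  have r1 : dotProduct A (Matrix.mulVec (F * Q * G) (star A)) = dotProduct A (Matrix.mulVec
      (G * Q * F * Q * G + F * Q * G * Q * F) (star A)) := by rw [hX]
  have r2 : dotProduct C (Matrix.mulVec Q (star C)) = dotProduct C (Matrix.mulVec
      (Q * F * Q + Q * G * Q) (star C)) := by rw [hQQ]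
  rw [r1, r2]
  simp only [star_add, star_sub, sA, Matrix.conjTranspose_mul, hF.eq, hG.eq, hQ.eq,
    Matrix.mulVec_add, Matrix.mulVec_sub, Matrix.mulVec_mulVec, add_dotProduct, sub_dotProduct,
    dotProduct_add, dotProduct_sub, ← Matrix.dotProduct_mulVec, Matrix.add_mulVec]
  simp only [mul_assoc] at c1 c2 ⊢
  rw [c1, c2]
  ring

lemma aux_cont {T : ℕ} (a : ℤ → Fin T → ℂ) (haSum : Summable fun j : ℤ => ∑ k, ‖a j k‖)
    (e : ℤ → ℝ → ℂ) (he : ∀ j, Continuous (e j)) (hb : ∀ j x, ‖e j x‖ = 1) (k : Fin T) :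
    Continuous fun x => ∑' j : ℤ, a j k * e j x := by
  refine continuous_tsum (fun j => continuous_const.mul (he j)) haSum (fun j x => ?_)
  rw [norm_mul, hb, mul_one]
  exact Finset.single_le_sum (f := fun k => ‖a j k‖) (fun i _ => norm_nonneg _) (Finset.mem_univ k)

lemma aux_int {T : ℕ} (A : ℝ → Fin T → ℂ) (hA : ∀ k, Continuous fun x => A x k)
    (N : ℝ → Matrix (Fin T) (Fin T) ℂ)
    (hN : ∀ p q, IntervalIntegrable (fun x => N x p q) volume (-Real.pi) Real.pi) :
    IntervalIntegrable (fun x => ∑ p, ∑ q, A x p * N x p q * (starRingEnd ℂ) (A x q))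
      volume (-Real.pi) Real.pi := by
  have : (fun x => ∑ p, ∑ q, A x p * N x p q * (starRingEnd ℂ) (A x q)) =
      ∑ p, ∑ q, fun x => A x p * N x p q * (starRingEnd ℂ) (A x q) := by
    ext x; simp
  rw [this]
  refine IntervalIntegrable.sum _ fun p _ => IntervalIntegrable.sum _ fun q _ => ?_
  refine ((hN p q).continuousOn_mul (hA p).continuousOn).mul_continuousOn ?_
  exact (Complex.continuous_conj.comp (hA q)).continuousOn

lemma aux_meas {T : ℕ} {μ : Measure ℝ} (A : ℝ → Fin T → ℂ)
    (hA : ∀ k, AEMeasurable (fun x => A x k) μ)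
    (N : ℝ → Matrix (Fin T) (Fin T) ℂ) (hN : ∀ p q, AEMeasurable (fun x => N x p q) μ) :
    AEStronglyMeasurable (fun x => ∑ p, ∑ q, A x p * N x p q * (starRingEnd ℂ) (A x q)) μ := by
  refine AEMeasurable.aestronglyMeasurable ?_
  refine Finset.aemeasurable_fun_sum _ fun p _ => Finset.aemeasurable_fun_sum _ fun q _ => ?_
  exact ((hA p).mul (hN p q)).mul (Complex.continuous_conj.measurable.comp_aemeasurable (hA q))

lemma aux_mul_meas {T : ℕ} {μ : Measure ℝ} (M N : ℝ → Matrix (Fin T) (Fin T) ℂ)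
    (hM : ∀ p q, AEMeasurable (fun x => M x p q) μ)
    (hN : ∀ p q, AEMeasurable (fun x => N x p q) μ) (p q : Fin T) :
    AEMeasurable (fun x => (M x * N x) p q) μ := by
  simp only [Matrix.mul_apply]
  exact Finset.aemeasurable_fun_sum _ fun r _ => (hM p r).mul (hN r q)

lemma aux_vec_meas {T : ℕ} {μ : Measure ℝ} (A : ℝ → Fin T → ℂ)
    (hA : ∀ k, AEMeasurable (fun x => A x k) μ) (N : ℝ → Matrix (Fin T) (Fin T) ℂ)
    (hN : ∀ p q, AEMeasurable (fun x => N x p q) μ) (q : Fin T) :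
    AEMeasurable (fun x => Matrix.vecMul (A x) (N x) q) μ := by
  simp only [Matrix.vecMul, dotProduct]
  exact Finset.aemeasurable_fun_sum _ fun r _ => (hA r).mul (hN r q)

lemma aux_norm_le {z w : ℂ} (hz : 0 ≤ z) (h : z ≤ w) : ‖z‖ ≤ ‖w‖ := by
  have hw := hz.trans h
  rw [Complex.le_def] at hz h hw
  have h1 : z = (z.re : ℂ) := Complex.ext rfl (by simpa using hz.2.symm)
  have h2 : w = (w.re : ℂ) := Complex.ext rfl (by simpa using hw.2.symm)
  rw [h1, h2, Complex.norm_real, Complex.norm_real, Real.norm_of_nonneg hz.1,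
    Real.norm_of_nonneg hw.1]
  exact h.1

lemma aux_psd_conj {T : ℕ} {N B : Matrix (Fin T) (Fin T) ℂ} (hN : N.PosSemidef) :
    (B.conjTranspose * N * B).PosSemidef := hN.conjTranspose_mul_mul_same B

/-- the mean-square error of the estimate with spectral characteristic
`h` satisfies
`Δ(h;F,G) = (1/2π)∫ Aᵀ F (F+G)⁻¹ G conj(A) dλ + (1/2π)∫ Cᵀ (F+G)⁻¹ conj(C) dλ`,
all integrals being finite. -/
theorem stmt_3
    (T s : ℕ) (hT : 1 ≤ T) (hs : 1 ≤ s)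
    (Mb Nb : ℕ → ℕ) (hM1 : 0 < Mb 1)
    (hMN : ∀ l, 1 ≤ l → l < s → Mb l + Nb l < Mb (l + 1))
    (S U ZS : Set ℤ)
    (hS : S = ⋃ l ∈ Finset.Icc 1 s, Set.Icc (-((Mb l : ℤ) + (Nb l : ℤ))) (-(Mb l : ℤ)))
    (hU : U = S ∪ {j : ℤ | 0 ≤ j})
    (hZS : ZS = {j : ℤ | 1 ≤ j} \ {j : ℤ | -j ∈ S})
    (F G : ℝ → Matrix (Fin T) (Fin T) ℂ)
    (hFmeas : ∀ p q, Measurable fun x => F x p q)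
    (hGmeas : ∀ p q, Measurable fun x => G x p q)
    (hFpsd : ∀ᵐ x : ℝ, x ∈ Set.Icc (-Real.pi) Real.pi → (F x).PosSemidef)
    (hGpsd : ∀ᵐ x : ℝ, x ∈ Set.Icc (-Real.pi) Real.pi → (G x).PosSemidef)
    (hFint : ∀ p q, IntervalIntegrable (fun x => F x p q) volume (-Real.pi) Real.pi)
    (hGint : ∀ p q, IntervalIntegrable (fun x => G x p q) volume (-Real.pi) Real.pi)
    (hinv : ∀ᵐ x : ℝ, x ∈ Set.Icc (-Real.pi) Real.pi → IsUnit (F x + G x))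
    (hmin : ∀ p q, IntervalIntegrable (fun x => (F x + G x)⁻¹ p q) volume (-Real.pi) Real.pi)
    (a : ℤ → Fin T → ℂ) (ha0 : ∀ j, j ∉ ZS → a j = 0)
    (haSum : Summable fun j : ℤ => ∑ k, ‖a j k‖)
    (A : ℝ → Fin T → ℂ)
    (hA : ∀ x k, A x k = ∑' j : ℤ, a j k * Complex.exp (-(Complex.I * (j : ℂ) * (x : ℂ))))
    (c : ℤ → Fin T → ℂ) (hc0 : ∀ j, j ∉ U → c j = 0)
    (hcSum : Summable fun j : ℤ => ∑ k, ‖c j k‖)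
    (Cf : ℝ → Fin T → ℂ)
    (hCf : ∀ x k, Cf x k = ∑' j : ℤ, c j k * Complex.exp (Complex.I * (j : ℂ) * (x : ℂ)))
    (h : ℝ → Fin T → ℂ)
    (hh : ∀ x, h x = Matrix.vecMul (A x) (F x * (F x + G x)⁻¹) -
      Matrix.vecMul (Cf x) (F x + G x)⁻¹)
    (Δ : (ℝ → Fin T → ℂ) → ℂ)
    (hΔ : ∀ g : ℝ → Fin T → ℂ, Δ g =
      (1 / (2 * (Real.pi : ℂ))) * (∫ x in (-Real.pi)..Real.pi,
        ∑ p, ∑ q, (A x p - g x p) * F x p q * (starRingEnd ℂ) (A x q - g x q)) +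
      (1 / (2 * (Real.pi : ℂ))) * (∫ x in (-Real.pi)..Real.pi,
        ∑ p, ∑ q, g x p * G x p q * (starRingEnd ℂ) (g x q))) :
    IntervalIntegrable (fun x => ∑ p, ∑ q,
        A x p * (F x * (F x + G x)⁻¹ * G x) p q * (starRingEnd ℂ) (A x q))
        volume (-Real.pi) Real.pi ∧
    IntervalIntegrable (fun x => ∑ p, ∑ q,
        Cf x p * (F x + G x)⁻¹ p q * (starRingEnd ℂ) (Cf x q))
        volume (-Real.pi) Real.pi ∧
    IntervalIntegrable (fun x => ∑ p, ∑ q,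
        (A x p - h x p) * F x p q * (starRingEnd ℂ) (A x q - h x q))
        volume (-Real.pi) Real.pi ∧
    IntervalIntegrable (fun x => ∑ p, ∑ q, h x p * G x p q * (starRingEnd ℂ) (h x q))
        volume (-Real.pi) Real.pi ∧
    Δ h = (1 / (2 * (Real.pi : ℂ))) * (∫ x in (-Real.pi)..Real.pi,
        ∑ p, ∑ q, A x p * (F x * (F x + G x)⁻¹ * G x) p q * (starRingEnd ℂ) (A x q)) +
      (1 / (2 * (Real.pi : ℂ))) * (∫ x in (-Real.pi)..Real.pi,
        ∑ p, ∑ q, Cf x p * (F x + G x)⁻¹ p q * (starRingEnd ℂ) (Cf x q)) := by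
  have hle : (-Real.pi) ≤ Real.pi := by linarith [Real.pi_pos]
  have hAc : ∀ k, Continuous fun x => A x k := by
    intro k; simp only [hA]
    refine aux_cont a haSum (fun j x => Complex.exp (-(Complex.I * (j : ℂ) * (x : ℂ))))
      (fun j => by fun_prop) (fun j x => ?_) k
    simp [Complex.norm_exp]
  have hCc : ∀ k, Continuous fun x => Cf x k := by
    intro k; simp only [hCf]
    refine aux_cont c hcSum (fun j x => Complex.exp (Complex.I * (j : ℂ) * (x : ℂ)))
      (fun j => by fun_prop) (fun j x => ?_) k
    simp [Complex.norm_exp]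
  set μ : Measure ℝ := volume.restrict (Set.Ioc (-Real.pi) Real.pi) with hμ
  have hI : ∀ f : ℝ → ℂ, IntervalIntegrable f volume (-Real.pi) Real.pi ↔ Integrable f μ :=
    fun f => intervalIntegrable_iff_integrableOn_Ioc_of_le hle
  have hQm : ∀ p q, AEMeasurable (fun x => (F x + G x)⁻¹ p q) μ :=
    fun p q => ((hI _).1 (hmin p q)).aestronglyMeasurable.aemeasurable
  have hFm : ∀ p q, AEMeasurable (fun x => F x p q) μ := fun p q => (hFmeas p q).aemeasurable
  have hGm : ∀ p q, AEMeasurable (fun x => G x p q) μ := fun p q => (hGmeas p q).aemeasurable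
  have hAm : ∀ k, AEMeasurable (fun x => A x k) μ := fun k => (hAc k).measurable.aemeasurable
  have hCm : ∀ k, AEMeasurable (fun x => Cf x k) μ := fun k => (hCc k).measurable.aemeasurable
  have hFQm := aux_mul_meas F (fun x => (F x + G x)⁻¹) hFm hQm
  have hFQGm := aux_mul_meas (fun x => F x * (F x + G x)⁻¹) G hFQm hGm
  have hhm : ∀ k, AEMeasurable (fun x => h x k) μ := by
    intro k
    simp only [hh, Pi.sub_apply]
    exact (aux_vec_meas A hAm _ hFQm k).sub (aux_vec_meas Cf hCm _ hQm k)
  have hall : ∀ᵐ x ∂μ, (F x).PosSemidef ∧ (G x).PosSemidef ∧ IsUnit (F x + G x) := by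
    rw [hμ, ae_restrict_iff' measurableSet_Ioc]
    filter_upwards [hFpsd, hGpsd, hinv] with x h1 h2 h3 hx
    have hx' := Set.Ioc_subset_Icc_self hx
    exact ⟨h1 hx', h2 hx', h3 hx'⟩
  have hpt : ∀ᵐ x ∂μ,
      (0 ≤ ∑ p, ∑ q, A x p * (F x * (F x + G x)⁻¹ * G x) p q * (starRingEnd ℂ) (A x q)) ∧
      (∑ p, ∑ q, A x p * (F x * (F x + G x)⁻¹ * G x) p q * (starRingEnd ℂ) (A x q) ≤
        ∑ p, ∑ q, A x p * G x p q * (starRingEnd ℂ) (A x q)) ∧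
      (0 ≤ ∑ p, ∑ q, (A x p - h x p) * F x p q * (starRingEnd ℂ) (A x q - h x q)) ∧
      (0 ≤ ∑ p, ∑ q, h x p * G x p q * (starRingEnd ℂ) (h x q)) ∧
      (∑ p, ∑ q, (A x p - h x p) * F x p q * (starRingEnd ℂ) (A x q - h x q)) +
      (∑ p, ∑ q, h x p * G x p q * (starRingEnd ℂ) (h x q)) =
    (∑ p, ∑ q, A x p * (F x * (F x + G x)⁻¹ * G x) p q * (starRingEnd ℂ) (A x q)) +
      (∑ p, ∑ q, Cf x p * (F x + G x)⁻¹ p q * (starRingEnd ℂ) (Cf x q)) := by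
    filter_upwards [hall] with x ⟨hF, hG, hu⟩
    have hdet := (Matrix.isUnit_iff_isUnit_det _).1 hu
    have h1 := Matrix.mul_nonsing_inv _ hdet
    have h2 := Matrix.nonsing_inv_mul _ hdet
    have hQ : ((F x + G x)⁻¹).PosSemidef := (hF.add hG).inv
    have hhx := hh x
    generalize (F x + G x)⁻¹ = Q at *
    have hX := aux_X h1 h2
    have hY := aux_Y h1 h2
    have hG2 : (G x * Q * G x).PosSemidef := by
      have := aux_psd_conj (B := G x) hQ
      rwa [hG.1.eq] at this
    have hXp : (F x * Q * G x).PosSemidef := by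
      rw [← hX]
      refine Matrix.PosSemidef.add ?_ ?_
      · have := aux_psd_conj (B := Q * G x) hF
        rw [Matrix.conjTranspose_mul, hG.1.eq, hQ.1.eq] at this
        simpa only [mul_assoc] using this
      · have := aux_psd_conj (B := Q * F x) hG
        rw [Matrix.conjTranspose_mul, hF.1.eq, hQ.1.eq] at this
        simpa only [mul_assoc] using this
    refine ⟨aux_nonneg _ hXp, ?_, aux_nonneg (fun k => A x k - h x k) hF, aux_nonneg _ hG,
      aux_key hF.1 hG.1 hQ.1 h1 h2 _ _ _ hhx⟩
    have hsum : ∑ p, ∑ q, A x p * G x p q * (starRingEnd ℂ) (A x q) =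
        ∑ p, ∑ q, A x p * (F x * Q * G x) p q * (starRingEnd ℂ) (A x q) +
        ∑ p, ∑ q, A x p * (G x * Q * G x) p q * (starRingEnd ℂ) (A x q) := by
      rw [aux_quad, aux_quad, aux_quad, ← dotProduct_add, ← Matrix.add_mulVec, hY]
    rw [hsum]
    exact le_add_of_nonneg_right (aux_nonneg _ hG2)
  have i1 : IntervalIntegrable (fun x => ∑ p, ∑ q,
        A x p * (F x * (F x + G x)⁻¹ * G x) p q * (starRingEnd ℂ) (A x q))
        volume (-Real.pi) Real.pi := by
    rw [hI]
    refine Integrable.mono ((hI _).1 (aux_int A hAc G hGint)) (aux_meas A hAm _ hFQGm) ?_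
    filter_upwards [hpt] with x hx
    exact aux_norm_le hx.1 hx.2.1
  have i2 := aux_int Cf hCc (fun x => (F x + G x)⁻¹) hmin
  have i12 := ((hI _).1 i1).add ((hI _).1 i2)
  have i3 : IntervalIntegrable (fun x => ∑ p, ∑ q,
        (A x p - h x p) * F x p q * (starRingEnd ℂ) (A x q - h x q))
        volume (-Real.pi) Real.pi := by
    rw [hI]
    refine Integrable.mono i12
      (aux_meas (fun x k => A x k - h x k) (fun k => (hAm k).sub (hhm k)) _ hFm) ?_
    filter_upwards [hpt] with x hx
    refine aux_norm_le hx.2.2.1 ?_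
    refine le_trans ?_ hx.2.2.2.2.le
    exact le_add_of_nonneg_right hx.2.2.2.1
  have i4 : IntervalIntegrable (fun x => ∑ p, ∑ q, h x p * G x p q * (starRingEnd ℂ) (h x q))
        volume (-Real.pi) Real.pi := by
    rw [hI]
    refine Integrable.mono i12 (aux_meas h hhm _ hGm) ?_
    filter_upwards [hpt] with x hx
    refine aux_norm_le hx.2.2.2.1 ?_
    refine le_trans ?_ hx.2.2.2.2.le
    exact le_add_of_nonneg_left hx.2.2.1
  refine ⟨i1, i2, i3, i4, ?_⟩
  rw [hΔ, ← mul_add, ← mul_add, ← intervalIntegral.integral_add i3 i4,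
    ← intervalIntegral.integral_add i1 i2, intervalIntegral.integral_of_le hle,
    intervalIntegral.integral_of_le hle]
  congr 1
  refine integral_congr_ae ?_
  filter_upwards [hpt] with x hx
  exact hx.2.2.2.2
end

section
/- Assume the setup below. For every k ∈ ℤ the k-th Fourier coefficient of the spectral characteristic h is given by (1/2π)∫_{−π}^{π} h(λ)^⊤ e^{−ikλ} dλ = Σ_{j∈Z^S} a(j)^⊤ R(k,j) − Σ_{j∈U} c(j)^⊤ B(k,j), both series converging absolutely. Consequently, the Fourier coefficients of h vanish at every k ∈ U (i.e. h lies in the span of the exponentials e^{inλ}, n ∈ Z₋∖S, corresponding to the observed data) if and only if c solves the normal system: Σ_{j∈Z^S} a(j)^⊤ R(k,j) = Σ_{j∈U} c(j)^⊤ B(k,j) for all k ∈ U. -/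
open MeasureTheory
open scoped ComplexOrder

lemma aux_key_s4 (m : ℝ → ℂ) (hm : IntervalIntegrable m volume (-Real.pi) Real.pi)
    (w : ℤ → ℂ) (hw : Summable fun j => ‖w j‖) (e : ℤ → ℝ → ℂ)
    (hec : ∀ j, Continuous (e j)) (he : ∀ j x, ‖e j x‖ ≤ 1) :
    HasSum (fun j => w j * ∫ x in (-Real.pi)..Real.pi, m x * e j x)
      (∫ x in (-Real.pi)..Real.pi, (∑' j, w j * e j x) * m x) ∧
    Summable (fun j => ‖w j * ∫ x in (-Real.pi)..Real.pi, m x * e j x‖) ∧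
    IntervalIntegrable (fun x => (∑' j, w j * e j x) * m x) volume (-Real.pi) Real.pi := by
  have hle : -Real.pi ≤ Real.pi := by linarith [Real.pi_pos]
  have hbd : ∀ j x, ‖w j * e j x‖ ≤ ‖w j‖ := fun j x => by
    rw [norm_mul]; exact mul_le_of_le_one_right (norm_nonneg _) (he j x)
  have hcont : Continuous fun x => ∑' j, w j * e j x :=
    continuous_tsum (fun j => continuous_const.mul (hec j)) hw hbd
  have hI := hm
  rw [intervalIntegrable_iff_integrableOn_Ioc_of_le hle] at hI
  have hF : ∀ j, Integrable (fun x => (w j * e j x) * m x)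
      (volume.restrict (Set.Ioc (-Real.pi) Real.pi)) := fun j =>
    hI.bdd_mul (c := ‖w j‖) (continuous_const.mul (hec j)).aestronglyMeasurable
      (Filter.Eventually.of_forall (hbd j))
  have hb : ∀ j, ∫ x in Set.Ioc (-Real.pi) Real.pi, ‖(w j * e j x) * m x‖
      ≤ ‖w j‖ * ∫ x in Set.Ioc (-Real.pi) Real.pi, ‖m x‖ := fun j => by
    rw [← integral_const_mul]
    refine integral_mono (hF j).norm (hI.norm.const_mul _) fun x => ?_
    simp only [norm_mul (w j * e j x)]
    exact mul_le_mul_of_nonneg_right (hbd j x) (norm_nonneg _)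
  have hs : Summable fun j => ∫ x in Set.Ioc (-Real.pi) Real.pi, ‖(w j * e j x) * m x‖ :=
    Summable.of_nonneg_of_le (fun j => integral_nonneg fun x => norm_nonneg _) hb
      (hw.mul_right _)
  have heq : ∀ j, w j * ∫ x in (-Real.pi)..Real.pi, m x * e j x =
      ∫ x in Set.Ioc (-Real.pi) Real.pi, (w j * e j x) * m x := fun j => by
    rw [intervalIntegral.integral_of_le hle, ← integral_const_mul]
    congr 1; ext x; ring
  refine ⟨?_, ?_, ?_⟩
  · have := hasSum_integral_of_summable_integral_norm hF hs
    simp only [heq]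
    rw [intervalIntegral.integral_of_le hle]
    simpa only [tsum_mul_right] using this
  · refine Summable.of_nonneg_of_le (fun j => norm_nonneg _) (fun j => ?_) hs
    rw [heq]; exact norm_integral_le_integral_norm _
  · rw [intervalIntegrable_iff_integrableOn_Ioc_of_le hle]
    exact hI.bdd_mul (c := ∑' j, ‖w j‖) hcont.aestronglyMeasurable
      (Filter.Eventually.of_forall fun x => tsum_of_norm_bounded hw.hasSum (fun j => hbd j x))

lemma aux_vec {T : ℕ} (M : ℝ → Matrix (Fin T) (Fin T) ℂ)
    (hM : ∀ p q, IntervalIntegrable (fun x => M x p q) volume (-Real.pi) Real.pi)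
    (w : ℤ → Fin T → ℂ) (hw : Summable fun j => ∑ p, ‖w j p‖) (e : ℤ → ℝ → ℂ)
    (hec : ∀ j, Continuous (e j)) (he : ∀ j x, ‖e j x‖ ≤ 1) (κ : ℂ)
    (K : ℤ → Matrix (Fin T) (Fin T) ℂ)
    (hK : ∀ j p q, K j p q = κ * ∫ x in (-Real.pi)..Real.pi, M x p q * e j x) :
    Summable (fun j => ∑ q, ‖Matrix.vecMul (w j) (K j) q‖) ∧
    (HasSum (fun j => Matrix.vecMul (w j) (K j))
      (fun q => κ * ∫ x in (-Real.pi)..Real.pi,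
        Matrix.vecMul (fun p => ∑' j, w j p * e j x) (M x) q)) ∧
    ∀ q, IntervalIntegrable (fun x => Matrix.vecMul (fun p => ∑' j, w j p * e j x) (M x) q)
      volume (-Real.pi) Real.pi := by
  have hwp : ∀ p, Summable fun j => ‖w j p‖ := fun p =>
    Summable.of_nonneg_of_le (fun j => norm_nonneg _)
      (fun j => Finset.single_le_sum (f := fun p => ‖w j p‖) (fun _ _ => norm_nonneg _)
        (Finset.mem_univ p)) hw
  have key := fun p q => aux_key_s4 (fun x => M x p q) (hM p q) (fun j => w j p) (hwp p) e hec he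
  have hv : ∀ j q, Matrix.vecMul (w j) (K j) q =
      ∑ p, κ * (w j p * ∫ x in (-Real.pi)..Real.pi, M x p q * e j x) := fun j q => by
    simp only [Matrix.vecMul, dotProduct, hK]
    exact Finset.sum_congr rfl fun p _ => by ring
  refine ⟨?_, ?_, ?_⟩
  · refine summable_sum fun q _ => ?_
    refine Summable.of_nonneg_of_le (fun j => norm_nonneg _) (fun j => ?_)
      (summable_sum (s := Finset.univ) fun p _ => ((key p q).2.1.mul_left ‖κ‖))
    rw [hv]
    refine (norm_sum_le _ _).trans (Finset.sum_le_sum fun p _ => ?_)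
    rw [norm_mul]
  · rw [Pi.hasSum]
    intro q
    have e1 : (fun j => Matrix.vecMul (w j) (K j) q) = fun j =>
      ∑ p, κ * (w j p * ∫ x in (-Real.pi)..Real.pi, M x p q * e j x) := funext fun j => hv j q
    change HasSum (fun j => Matrix.vecMul (w j) (K j) q) _
    rw [e1]
    have h1 := hasSum_sum (s := Finset.univ) fun p _ => ((key p q).1.mul_left κ)
    have e3 : (κ * ∫ x in (-Real.pi)..Real.pi,
        Matrix.vecMul (fun p => ∑' j, w j p * e j x) (M x) q) =
        ∑ p, κ * ∫ x in (-Real.pi)..Real.pi, (∑' j, w j p * e j x) * M x p q := by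
      simp only [Matrix.vecMul, dotProduct]
      rw [intervalIntegral.integral_finsetSum fun p _ => (key p q).2.2, Finset.mul_sum]
    rw [e3]; exact h1
  · intro q
    simp only [Matrix.vecMul, dotProduct]
    have := IntervalIntegrable.sum (μ := volume) (a := -Real.pi) (b := Real.pi) Finset.univ
      (f := fun p x => (∑' j, w j p * e j x) * M x p q) fun p _ => (key p q).2.2
    have e2 : (fun x => ∑ p, (∑' j, w j p * e j x) * M x p q) =
        ∑ p, fun x => (∑' j, w j p * e j x) * M x p q := by
      ext x; simp
    rw [e2]; exact this

open scoped Matrix in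
lemma aux_bound {T : ℕ} (F G : Matrix (Fin T) (Fin T) ℂ) (hF : F.PosSemidef)
    (hG : G.PosSemidef) (hu : IsUnit (F + G)) (p q : Fin T) :
    ‖(F * (F + G)⁻¹) p q‖ ≤ ‖F p p‖ + ‖(F + G)⁻¹ q q‖ := by
  set Q := (F + G)⁻¹ with hQ
  have hdet : IsUnit (F + G).det := (Matrix.isUnit_iff_isUnit_det _).mp hu
  have hQH : Q.IsHermitian := (hF.isHermitian.add hG.isHermitian).inv
  have hQP : (Q * (F + G) * Q) = Q := by rw [hQ, Matrix.nonsing_inv_mul _ hdet, one_mul]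
  -- Q F Q + Q G Q = Q
  have hA : (Qᴴ * F * Q).PosSemidef := hF.conjTranspose_mul_mul_same Q
  have hB : (Qᴴ * G * Q).PosSemidef := hG.conjTranspose_mul_mul_same Q
  rw [hQH.eq] at hA hB
  have hsum : Q * F * Q + Q * G * Q = Q := by
    rw [← Matrix.add_mul, ← Matrix.mul_add, hQP]
  have hle : (Q * F * Q) q q ≤ Q q q := by
    have h1 : Q q q = (Q * F * Q) q q + (Q * G * Q) q q := by
      conv_lhs => rw [← hsum]
      rfl
    rw [h1]; exact le_add_of_nonneg_right hB.diag_nonneg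
  have hnle : ‖(Q * F * Q) q q‖ ≤ ‖Q q q‖ :=
    CStarAlgebra.norm_le_norm_of_nonneg_of_le hA.diag_nonneg hle
  set z := (F * Q) p q with hz
  have hz' : (Q * F) q p = star z := by
    have : (F * Q)ᴴ = Q * F := by rw [Matrix.conjTranspose_mul, hQH.eq, hF.isHermitian.eq]
    rw [← this]; rfl
  -- quadratic form
  have hquad : ∀ u : ℂ, 0 ≤ star u * u * F p p + star u * z + u * star z + (Q * F * Q) q q := by
    intro u
    let V : Matrix (Fin T) (Fin 1) ℂ := fun i _ => u * (1 : Matrix (Fin T) (Fin T) ℂ) i p + Q i q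
    have h0 := (hF.conjTranspose_mul_mul_same V).diag_nonneg (i := 0)
    have hV : V = u • (1 : Matrix (Fin T) (Fin T) ℂ).submatrix id (fun _ : Fin 1 => p)
        + Q.submatrix id (fun _ : Fin 1 => q) := by
      ext i j; rfl
    have hm : ∀ (X Y : Matrix (Fin T) (Fin T) ℂ) (i j : Fin T),
        ((X.submatrix id (fun _ : Fin 1 => i))ᴴ * F * Y.submatrix id (fun _ : Fin 1 => j)) 0 0
        = (Xᴴ * F * Y) i j := by
      intro X Y i j
      simp [Matrix.mul_apply]
    rw [hV] at h0
    simp only [Matrix.conjTranspose_add, Matrix.conjTranspose_smul, Matrix.add_mul,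
      Matrix.mul_add, Matrix.smul_mul, Matrix.mul_smul, Matrix.add_apply, Matrix.smul_apply, hm,
      smul_eq_mul, hQH.eq, Matrix.conjTranspose_one, Matrix.one_mul, Matrix.mul_one, hz', ← hz]
      at h0
    convert h0 using 1
    ring
  by_cases hz0 : z = 0
  · rw [hz0, norm_zero]; positivity
  have hn : (‖z‖ : ℂ) ≠ 0 := by simpa using hz0
  have hzz : star z * z = (‖z‖ : ℂ) ^ 2 := Complex.conj_mul' z
  have h1 := hquad (-(z / ‖z‖))
  have e1 : star (-(z / (‖z‖ : ℂ))) = -(star z / ‖z‖) := by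
    simp
  rw [e1] at h1
  have e2 : -(star z / (‖z‖ : ℂ)) * -(z / ‖z‖) * F p p + -(star z / ‖z‖) * z
      + -(z / ‖z‖) * star z + (Q * F * Q) q q = F p p - 2 * ‖z‖ + (Q * F * Q) q q := by
    have : -(star z / (‖z‖ : ℂ)) * -(z / ‖z‖) = 1 := by
      field_simp; linear_combination hzz
    rw [this]
    have : -(star z / (‖z‖ : ℂ)) * z = - ‖z‖ := by
      field_simp; linear_combination -hzz
    rw [this]
    have : -(z / (‖z‖ : ℂ)) * star z = - ‖z‖ := by
      field_simp; linear_combination -hzz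
    rw [this]; ring
  rw [e2] at h1
  have h2 := (Complex.le_def.mp h1).1
  simp at h2
  have h3 := Complex.re_le_norm (F p p)
  have h4 := Complex.re_le_norm ((Q * F * Q) q q)
  have := norm_nonneg z
  linarith

/-- for every `k ∈ ℤ` the `k`-th Fourier coefficient of the spectral
characteristic `h` equals `Σ_{j∈Z^S} a(j)ᵀ R(k,j) − Σ_{j∈U} c(j)ᵀ B(k,j)`, both
series converging absolutely; consequently the Fourier coefficients of `h` vanish
on `U` iff `c` solves the normal system. -/
theorem stmt_4
    (T s : ℕ) (hT : 1 ≤ T) (hs : 1 ≤ s)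
    (Mb Nb : ℕ → ℕ) (hM1 : 0 < Mb 1)
    (hMN : ∀ l, 1 ≤ l → l < s → Mb l + Nb l < Mb (l + 1))
    (S U ZS Zneg : Set ℤ)
    (hS : S = ⋃ l ∈ Finset.Icc 1 s, Set.Icc (-((Mb l : ℤ) + (Nb l : ℤ))) (-(Mb l : ℤ)))
    (hU : U = S ∪ {j : ℤ | 0 ≤ j})
    (hZS : ZS = {j : ℤ | 1 ≤ j} \ {j : ℤ | -j ∈ S})
    (hZneg : Zneg = {j : ℤ | j < 0})
    (F G : ℝ → Matrix (Fin T) (Fin T) ℂ)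
    (hFmeas : ∀ p q, Measurable fun x => F x p q)
    (hGmeas : ∀ p q, Measurable fun x => G x p q)
    (hFpsd : ∀ᵐ x : ℝ, x ∈ Set.Icc (-Real.pi) Real.pi → (F x).PosSemidef)
    (hGpsd : ∀ᵐ x : ℝ, x ∈ Set.Icc (-Real.pi) Real.pi → (G x).PosSemidef)
    (hFint : ∀ p q, IntervalIntegrable (fun x => F x p q) volume (-Real.pi) Real.pi)
    (hGint : ∀ p q, IntervalIntegrable (fun x => G x p q) volume (-Real.pi) Real.pi)
    (hinv : ∀ᵐ x : ℝ, x ∈ Set.Icc (-Real.pi) Real.pi → IsUnit (F x + G x))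
    (hmin : ∀ p q, IntervalIntegrable (fun x => (F x + G x)⁻¹ p q) volume (-Real.pi) Real.pi)
    (a : ℤ → Fin T → ℂ) (ha0 : ∀ j, j ∉ ZS → a j = 0)
    (haSum : Summable fun j : ℤ => ∑ k, ‖a j k‖)
    (A : ℝ → Fin T → ℂ)
    (hA : ∀ x k, A x k = ∑' j : ℤ, a j k * Complex.exp (-(Complex.I * (j : ℂ) * (x : ℂ))))
    (c : ℤ → Fin T → ℂ) (hc0 : ∀ j, j ∉ U → c j = 0)
    (hcSum : Summable fun j : ℤ => ∑ k, ‖c j k‖)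
    (Cf : ℝ → Fin T → ℂ)
    (hCf : ∀ x k, Cf x k = ∑' j : ℤ, c j k * Complex.exp (Complex.I * (j : ℂ) * (x : ℂ)))
    (h : ℝ → Fin T → ℂ)
    (hh : ∀ x, h x = Matrix.vecMul (A x) (F x * (F x + G x)⁻¹) -
      Matrix.vecMul (Cf x) (F x + G x)⁻¹)
    (B R : ℤ → ℤ → Matrix (Fin T) (Fin T) ℂ)
    (hB : ∀ k j p q, B k j p q = (1 / (2 * (Real.pi : ℂ))) *
      ∫ x in (-Real.pi)..Real.pi,
        (F x + G x)⁻¹ p q * Complex.exp (-(Complex.I * ((k : ℂ) - (j : ℂ)) * (x : ℂ))))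
    (hR : ∀ k j p q, R k j p q = (1 / (2 * (Real.pi : ℂ))) *
      ∫ x in (-Real.pi)..Real.pi,
        (F x * (F x + G x)⁻¹) p q * Complex.exp (-(Complex.I * ((k : ℂ) + (j : ℂ)) * (x : ℂ)))) :
    (∀ k : ℤ,
      Summable (fun j : ℤ => ∑ q, ‖Matrix.vecMul (a j) (R k j) q‖) ∧
      Summable (fun j : ℤ => ∑ q, ‖Matrix.vecMul (c j) (B k j) q‖) ∧
      (fun q => (1 / (2 * (Real.pi : ℂ))) *
          ∫ x in (-Real.pi)..Real.pi,
            h x q * Complex.exp (-(Complex.I * (k : ℂ) * (x : ℂ)))) =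
        (∑' j : ℤ, Matrix.vecMul (a j) (R k j)) - ∑' j : ℤ, Matrix.vecMul (c j) (B k j)) ∧
    ((∀ k ∈ U, ∀ q, (1 / (2 * (Real.pi : ℂ))) *
        (∫ x in (-Real.pi)..Real.pi,
          h x q * Complex.exp (-(Complex.I * (k : ℂ) * (x : ℂ)))) = 0) ↔
      ∀ k ∈ U, (∑' j : ℤ, Matrix.vecMul (a j) (R k j)) =
        ∑' j : ℤ, Matrix.vecMul (c j) (B k j)) := by
  have hle : -Real.pi ≤ Real.pi := by linarith [Real.pi_pos]
  have hM : ∀ p q, IntervalIntegrable (fun x => (F x * (F x + G x)⁻¹) p q) volume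
      (-Real.pi) Real.pi := by
    intro p q
    have hFp := (hFint p p).norm
    have hQq := (hmin q q).norm
    refine (hFp.add hQq).mono_fun' ?_ ?_
    · simp only [Matrix.mul_apply]
      refine Finset.aestronglyMeasurable_fun_sum _ fun i _ => ?_
      exact (hFmeas p i).aestronglyMeasurable.mul (by rw [Set.uIoc_of_le hle]; exact (hmin i q).1.aestronglyMeasurable)
    · rw [Set.uIoc_of_le hle]
      filter_upwards [ae_restrict_of_ae hFpsd, ae_restrict_of_ae hGpsd, ae_restrict_of_ae hinv,
        ae_restrict_mem measurableSet_Ioc] with x h1 h2 h3 hx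
      have hx' := Set.Ioc_subset_Icc_self hx
      exact aux_bound (F x) (G x) (h1 hx') (h2 hx') (h3 hx') p q
  have main : ∀ k : ℤ,
      Summable (fun j : ℤ => ∑ q, ‖Matrix.vecMul (a j) (R k j) q‖) ∧
      Summable (fun j : ℤ => ∑ q, ‖Matrix.vecMul (c j) (B k j) q‖) ∧
      (fun q => (1 / (2 * (Real.pi : ℂ))) *
          ∫ x in (-Real.pi)..Real.pi,
            h x q * Complex.exp (-(Complex.I * (k : ℂ) * (x : ℂ)))) =
        (∑' j : ℤ, Matrix.vecMul (a j) (R k j)) - ∑' j : ℤ, Matrix.vecMul (c j) (B k j) := by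
    intro k
    obtain ⟨r1, r2, r3⟩ := aux_vec (fun x => F x * (F x + G x)⁻¹) hM a haSum
      (fun j x => Complex.exp (-(Complex.I * ((k : ℂ) + (j : ℂ)) * (x : ℂ))))
      (fun j => by fun_prop) (fun j x => by simp [Complex.norm_exp]) _ (R k) (hR k)
    obtain ⟨b1, b2, b3⟩ := aux_vec (fun x => (F x + G x)⁻¹) hmin c hcSum
      (fun j x => Complex.exp (-(Complex.I * ((k : ℂ) - (j : ℂ)) * (x : ℂ))))
      (fun j => by fun_prop) (fun j x => by simp [Complex.norm_exp]) _ (B k) (hB k)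
    refine ⟨r1, b1, ?_⟩
    rw [r2.tsum_eq, b2.tsum_eq]
    ext q
    rw [Pi.sub_apply, ← mul_sub, ← intervalIntegral.integral_sub (r3 q) (b3 q)]
    congr 2
    ext x
    have eA : (fun p => ∑' j : ℤ, a j p * Complex.exp (-(Complex.I * ((k : ℂ) + (j : ℂ)) * (x : ℂ))))
        = Complex.exp (-(Complex.I * (k : ℂ) * (x : ℂ))) • A x := by
      ext p
      rw [Pi.smul_apply, hA, smul_eq_mul, ← tsum_mul_left]
      congr 1; ext j
      rw [mul_left_comm, ← Complex.exp_add]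
      congr 2; ring
    have eC : (fun p => ∑' j : ℤ, c j p * Complex.exp (-(Complex.I * ((k : ℂ) - (j : ℂ)) * (x : ℂ))))
        = Complex.exp (-(Complex.I * (k : ℂ) * (x : ℂ))) • Cf x := by
      ext p
      rw [Pi.smul_apply, hCf, smul_eq_mul, ← tsum_mul_left]
      congr 1; ext j
      rw [mul_left_comm, ← Complex.exp_add]
      congr 2; ring
    rw [eA, eC, hh, Matrix.smul_vecMul, Matrix.smul_vecMul]
    simp only [Pi.sub_apply, Pi.smul_apply, smul_eq_mul]
    ring
  refine ⟨main, forall₂_congr fun k _ => ?_⟩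
  rw [← sub_eq_zero (a := ∑' j : ℤ, Matrix.vecMul (a j) (R k j)), ← (main k).2.2, funext_iff]
  rfl
end

section
/- Assume the setup below, and assume additionally that the entries of F and G are essentially bounded on [−π,π]. Let g⁰ : [−π,π] → ℂ^T be square integrable with Δ(g⁰;F,G) < ∞ and suppose that (i) the Fourier coefficients ∫_{−π}^{π} g⁰(λ) e^{−ikλ} dλ vanish for every k ∈ U, and (ii) the orthogonality conditions hold: for every j ∈ Z₋∖S, (1/2π)∫_{−π}^{π} [ (A(λ)−g⁰(λ))^⊤ F(λ) − g⁰(λ)^⊤ G(λ) ] e^{−ijλ} dλ = 0 (the zero row vector in ℂ^T). Then g⁰ is optimal: Δ(g⁰;F,G) ≤ Δ(g;F,G) for every square integrable g : [−π,π] → ℂ^T whose Fourier coefficients vanish at every k ∈ U. -/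
open MeasureTheory
open scoped ComplexOrder

set_option maxHeartbeats 2000000 in
/-- Parseval: complementary vanishing of Fourier coefficients gives orthogonality. -/
theorem aux_parseval (f h : ℝ → ℂ)
    (hf : MemLp f 2 (volume.restrict (Set.Ioc (-Real.pi) Real.pi)))
    (hh : MemLp h 2 (volume.restrict (Set.Ioc (-Real.pi) Real.pi)))
    (H : ∀ k : ℤ, (∫ x in (-Real.pi)..Real.pi,
        f x * Complex.exp (-(Complex.I * (k : ℂ) * (x : ℂ)))) = 0 ∨
      (∫ x in (-Real.pi)..Real.pi,
        h x * Complex.exp (-(Complex.I * (k : ℂ) * (x : ℂ)))) = 0) :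
    ∫ x in (-Real.pi)..Real.pi, f x * (starRingEnd ℂ) (h x) = 0 := by
  have hpi := Real.pi_pos
  have : Fact (0 < 2 * Real.pi) := ⟨by positivity⟩
  have e : -Real.pi + 2 * Real.pi = Real.pi := by ring
  have hab : -Real.pi < -Real.pi + 2 * Real.pi := by linarith
  have key : ∀ u : ℝ → ℂ, ∀ k : ℤ, (∫ x in (-Real.pi)..Real.pi,
        u x * Complex.exp (-(Complex.I * (k : ℂ) * (x : ℂ)))) = 0 →
      fourierCoeff (AddCircle.liftIoc (2 * Real.pi) (-Real.pi) u) k = 0 := by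
    intro u k hu
    rw [fourierCoeff_eq_intervalIntegral _ _ (-Real.pi)]
    rw [intervalIntegral.integral_congr_ae (g := fun x : ℝ =>
      u x * Complex.exp (-(Complex.I * (k : ℂ) * (x : ℂ)))), e, hu, smul_zero]
    refine Filter.Eventually.of_forall fun x hx => ?_
    rw [Set.uIoc_of_le hab.le] at hx
    rw [AddCircle.liftIoc_coe_apply hx, fourier_coe_apply, smul_eq_mul, mul_comm]
    congr 2
    have : (Real.pi : ℂ) ≠ 0 := by exact_mod_cast hpi.ne'
    push_cast
    field_simp
  have es : Set.Ioc (-Real.pi) Real.pi = Set.Ioc (-Real.pi) (-Real.pi + 2 * Real.pi) := by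
    rw [e]
  rw [es] at hf hh
  have hf' := hf.memLp_liftIoc.haarAddCircle
  have hh' := hh.memLp_liftIoc.haarAddCircle
  have hs := fourierBasis.hasSum_inner_mul_inner hh'.toLp hf'.toLp
  have hz : (fun i : ℤ => inner ℂ hh'.toLp (fourierBasis i) * inner ℂ (fourierBasis i) hf'.toLp)
      = fun _ => 0 := by
    funext i
    rw [← inner_conj_symm, ← fourierBasis.repr_apply_apply, ← fourierBasis.repr_apply_apply,
      fourierBasis_repr, fourierBasis_repr, fourierCoeff_congr_ae hh'.coeFn_toLp,
      fourierCoeff_congr_ae hf'.coeFn_toLp]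
    rcases H i with h1 | h1
    · rw [key f i h1, mul_zero]
    · rw [key h i h1, map_zero, zero_mul]
  rw [hz] at hs
  have h0 := hs.unique hasSum_zero
  rw [MeasureTheory.L2.inner_def] at h0
  have h1 : ∫ t, AddCircle.liftIoc (2 * Real.pi) (-Real.pi)
      (fun x => f x * (starRingEnd ℂ) (h x)) t ∂AddCircle.haarAddCircle = 0 := by
    rw [← h0]
    apply integral_congr_ae
    filter_upwards [hh'.coeFn_toLp, hf'.coeFn_toLp] with t h2 h3
    rw [h2, h3, RCLike.inner_apply]
    rfl
  rw [AddCircle.integral_haarAddCircle, AddCircle.integral_liftIoc_eq_intervalIntegral, e] at h1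
  exact (smul_eq_zero.mp h1).resolve_left (by positivity)

theorem aux_psd {T : ℕ} (M : Matrix (Fin T) (Fin T) ℂ) (hM : M.PosSemidef) (u w : Fin T → ℂ) :
    (∑ p, ∑ q, u p * M p q * (starRingEnd ℂ) (u q)).re +
      2 * (∑ q, (∑ p, u p * M p q) * (starRingEnd ℂ) (w q)).re ≤
    (∑ p, ∑ q, (u p + w p) * M p q * (starRingEnd ℂ) (u q + w q)).re := by
  have hsym : ∀ p q, M p q = (starRingEnd ℂ) (M q p) := fun p q => (hM.1.apply p q).symm
  have hnn : 0 ≤ (∑ p, ∑ q, w p * M p q * (starRingEnd ℂ) (w q)).re := by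
    have := hM.dotProduct_mulVec_nonneg (star w)
    have h2 := (Complex.le_def.mp this).1
    simpa [dotProduct, Matrix.mulVec, Finset.mul_sum, mul_assoc] using h2
  have hB : (∑ q, (∑ p, u p * M p q) * (starRingEnd ℂ) (w q)) =
      ∑ p, ∑ q, u p * M p q * (starRingEnd ℂ) (w q) := by
    simp_rw [Finset.sum_mul]; rw [Finset.sum_comm]
  have hC : (∑ p, ∑ q, w p * M p q * (starRingEnd ℂ) (u q)) =
      (starRingEnd ℂ) (∑ p, ∑ q, u p * M p q * (starRingEnd ℂ) (w q)) := by
    rw [Finset.sum_comm]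
    simp only [map_sum, map_mul, Complex.conj_conj]
    refine Finset.sum_congr rfl fun p _ => Finset.sum_congr rfl fun q _ => ?_
    rw [← hsym]; ring
  have hE : (∑ p, ∑ q, (u p + w p) * M p q * (starRingEnd ℂ) (u q + w q)) =
      (∑ p, ∑ q, u p * M p q * (starRingEnd ℂ) (u q)) +
      (∑ p, ∑ q, u p * M p q * (starRingEnd ℂ) (w q)) +
      (∑ p, ∑ q, w p * M p q * (starRingEnd ℂ) (u q)) +
      (∑ p, ∑ q, w p * M p q * (starRingEnd ℂ) (w q)) := by
    simp only [← Finset.sum_add_distrib, map_add]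
    refine Finset.sum_congr rfl fun p _ => Finset.sum_congr rfl fun q _ => ?_
    ring
  rw [hE, hB, hC]
  simp only [Complex.add_re, Complex.conj_re]
  linarith

/-- if `g⁰` is square integrable with finite error, its Fourier
coefficients vanish on `U` (membership in the subspace of observed exponentials),
and the orthogonality conditions `(1/2π)∫ [(A−g⁰)ᵀF − g⁰ᵀG] e^{−ijλ} dλ = 0`
hold for all `j ∈ Z₋∖S`, then `g⁰` is optimal among all square integrable `g`
whose Fourier coefficients vanish on `U` (the densities `F`, `G` being in
addition essentially bounded). -/
theorem stmt_7
    (T s : ℕ) (hT : 1 ≤ T) (hs : 1 ≤ s)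
    (Mb Nb : ℕ → ℕ) (hM1 : 0 < Mb 1)
    (hMN : ∀ l, 1 ≤ l → l < s → Mb l + Nb l < Mb (l + 1))
    (S U ZS Zneg : Set ℤ)
    (hS : S = ⋃ l ∈ Finset.Icc 1 s, Set.Icc (-((Mb l : ℤ) + (Nb l : ℤ))) (-(Mb l : ℤ)))
    (hU : U = S ∪ {j : ℤ | 0 ≤ j})
    (hZS : ZS = {j : ℤ | 1 ≤ j} \ {j : ℤ | -j ∈ S})
    (hZneg : Zneg = {j : ℤ | j < 0})
    (F G : ℝ → Matrix (Fin T) (Fin T) ℂ)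
    (hFmeas : ∀ p q, Measurable fun x => F x p q)
    (hGmeas : ∀ p q, Measurable fun x => G x p q)
    (hFpsd : ∀ᵐ x : ℝ, x ∈ Set.Icc (-Real.pi) Real.pi → (F x).PosSemidef)
    (hGpsd : ∀ᵐ x : ℝ, x ∈ Set.Icc (-Real.pi) Real.pi → (G x).PosSemidef)
    (hFint : ∀ p q, IntervalIntegrable (fun x => F x p q) volume (-Real.pi) Real.pi)
    (hGint : ∀ p q, IntervalIntegrable (fun x => G x p q) volume (-Real.pi) Real.pi)
    (hinv : ∀ᵐ x : ℝ, x ∈ Set.Icc (-Real.pi) Real.pi → IsUnit (F x + G x))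
    (hmin : ∀ p q, IntervalIntegrable (fun x => (F x + G x)⁻¹ p q) volume (-Real.pi) Real.pi)
    (K : ℝ)
    (hbdd : ∀ᵐ x : ℝ, x ∈ Set.Icc (-Real.pi) Real.pi →
      ∀ p q, ‖F x p q‖ ≤ K ∧ ‖G x p q‖ ≤ K)
    (a : ℤ → Fin T → ℂ) (ha0 : ∀ j, j ∉ ZS → a j = 0)
    (haSum : Summable fun j : ℤ => ∑ k, ‖a j k‖)
    (A : ℝ → Fin T → ℂ)
    (hA : ∀ x k, A x k = ∑' j : ℤ, a j k * Complex.exp (-(Complex.I * (j : ℂ) * (x : ℂ))))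
    (Δ : (ℝ → Fin T → ℂ) → ℂ)
    (hΔ : ∀ g : ℝ → Fin T → ℂ, Δ g =
      (1 / (2 * (Real.pi : ℂ))) * (∫ x in (-Real.pi)..Real.pi,
        ∑ p, ∑ q, (A x p - g x p) * F x p q * (starRingEnd ℂ) (A x q - g x q)) +
      (1 / (2 * (Real.pi : ℂ))) * (∫ x in (-Real.pi)..Real.pi,
        ∑ p, ∑ q, g x p * G x p q * (starRingEnd ℂ) (g x q)))
    (g0 : ℝ → Fin T → ℂ)
    (hg0meas : ∀ k, Measurable fun x => g0 x k)
    (hg0L2 : ∀ k, IntervalIntegrable (fun x => ‖g0 x k‖ ^ 2)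
      volume (-Real.pi) Real.pi)
    (hg0fin1 : IntervalIntegrable (fun x => ∑ p, ∑ q,
        (A x p - g0 x p) * F x p q * (starRingEnd ℂ) (A x q - g0 x q))
      volume (-Real.pi) Real.pi)
    (hg0fin2 : IntervalIntegrable (fun x => ∑ p, ∑ q,
        g0 x p * G x p q * (starRingEnd ℂ) (g0 x q)) volume (-Real.pi) Real.pi)
    (hg0U : ∀ k ∈ U, ∀ q, (∫ x in (-Real.pi)..Real.pi,
        g0 x q * Complex.exp (-(Complex.I * (k : ℂ) * (x : ℂ)))) = 0)
    (horth : ∀ j ∈ Zneg \ S, ∀ q, (1 / (2 * (Real.pi : ℂ))) *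
      (∫ x in (-Real.pi)..Real.pi,
        ((∑ p, (A x p - g0 x p) * F x p q) - ∑ p, g0 x p * G x p q) *
          Complex.exp (-(Complex.I * (j : ℂ) * (x : ℂ)))) = 0) :
    ∀ g : ℝ → Fin T → ℂ, (∀ k, Measurable fun x => g x k) →
      (∀ k, IntervalIntegrable (fun x => ‖g x k‖ ^ 2)
        volume (-Real.pi) Real.pi) →
      (∀ k ∈ U, ∀ q, (∫ x in (-Real.pi)..Real.pi,
        g x q * Complex.exp (-(Complex.I * (k : ℂ) * (x : ℂ)))) = 0) →
      (Δ g0).re ≤ (Δ g).re := by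
  intro g hgm hg2 hgU
  have hle : -Real.pi ≤ Real.pi := by linarith [Real.pi_pos]
  set μ := (volume : Measure ℝ).restrict (Set.Ioc (-Real.pi) Real.pi) with hμ
  have L2 : ∀ u : ℝ → ℂ, Measurable u →
      IntervalIntegrable (fun x => ‖u x‖ ^ 2) volume (-Real.pi) Real.pi → MemLp u 2 μ := by
    intro u hu hi
    rw [memLp_two_iff_integrable_sq_norm hu.aestronglyMeasurable]
    exact (intervalIntegrable_iff_integrableOn_Ioc_of_le hle).1 hi
  have ae_of : ∀ P : ℝ → Prop, (∀ᵐ x : ℝ, x ∈ Set.Icc (-Real.pi) Real.pi → P x) →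
      ∀ᵐ x ∂μ, P x := by
    intro P hP
    rw [hμ, ae_restrict_iff' measurableSet_Ioc]
    filter_upwards [hP] with x hx h
    exact hx (Set.Ioc_subset_Icc_self h)
  have hb := ae_of _ hbdd
  have hFp := ae_of _ hFpsd
  have hGp := ae_of _ hGpsd
  have hFT : ∀ p q, MemLp (fun x => F x p q) ⊤ μ := fun p q =>
    memLp_top_of_bound (hFmeas p q).aestronglyMeasurable K (hb.mono fun x h => (h p q).1)
  have hGT : ∀ p q, MemLp (fun x => G x p q) ⊤ μ := fun p q =>
    memLp_top_of_bound (hGmeas p q).aestronglyMeasurable K (hb.mono fun x h => (h p q).2)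
  have hA2 : ∀ k, MemLp (fun x => A x k) 2 μ := by
    intro k
    have hsk : Summable fun j : ℤ => ‖a j k‖ :=
      Summable.of_nonneg_of_le (fun _ => norm_nonneg _)
        (fun j => Finset.single_le_sum (f := fun k => ‖a j k‖)
          (fun _ _ => norm_nonneg _) (Finset.mem_univ k)) haSum
    have hn : ∀ (j : ℤ) (x : ℝ),
        ‖a j k * Complex.exp (-(Complex.I * (j : ℂ) * (x : ℂ)))‖ = ‖a j k‖ := by
      intro j x
      rw [norm_mul, Complex.norm_exp]
      simp
    have hc : Continuous fun x => A x k := by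
      simp_rw [hA]
      exact continuous_tsum (fun j => by fun_prop) hsk (fun j x => (hn j x).le)
    refine (memLp_top_of_bound hc.aestronglyMeasurable (∑' j, ‖a j k‖)
      (Filter.Eventually.of_forall fun x => ?_)).mono_exponent le_top
    rw [hA]
    refine (norm_tsum_le_tsum_norm ?_).trans_eq (tsum_congr fun j => hn j x)
    simpa only [hn] using hsk
  have hg2' : ∀ k, MemLp (fun x => g x k) 2 μ := fun k => L2 _ (hgm k) (hg2 k)
  have hg02' : ∀ k, MemLp (fun x => g0 x k) 2 μ := fun k => L2 _ (hg0meas k) (hg0L2 k)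
  have hlin : ∀ (v : ℝ → Fin T → ℂ) (M : ℝ → Matrix (Fin T) (Fin T) ℂ),
      (∀ k, MemLp (fun x => v x k) 2 μ) → (∀ p q, MemLp (fun x => M x p q) ⊤ μ) →
      ∀ p q, MemLp (fun x => v x p * M x p q) 2 μ := by
    intro v M hv hM p q
    exact (hM p q).mul' (hv p)
  have hmulI : ∀ u v : ℝ → ℂ, MemLp u 2 μ → MemLp v 2 μ →
      Integrable (fun x => u x * (starRingEnd ℂ) (v x)) μ := by
    intro u v hu hv
    exact hu.integrable_mul hv.star
  have hquad : ∀ (v : ℝ → Fin T → ℂ) (M : ℝ → Matrix (Fin T) (Fin T) ℂ),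
      (∀ k, MemLp (fun x => v x k) 2 μ) → (∀ p q, MemLp (fun x => M x p q) ⊤ μ) →
      Integrable (fun x => ∑ p, ∑ q, v x p * M x p q * (starRingEnd ℂ) (v x q)) μ := by
    intro v M hv hM
    exact integrable_finsetSum _ fun p _ => integrable_finsetSum _ fun q _ =>
      hmulI _ _ (hlin v M hv hM p q) (hv q)
  set r : ℝ → Fin T → ℂ := fun x q =>
    (∑ p, (A x p - g0 x p) * F x p q) - ∑ p, g0 x p * G x p q with hr
  have hr2 : ∀ q, MemLp (fun x => r x q) 2 μ := by
    intro q
    exact (memLp_finsetSum _ fun p _ =>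
        hlin (fun x p => A x p - g0 x p) F (fun k => (hA2 k).sub (hg02' k)) hFT p q).sub
      (memLp_finsetSum _ fun p _ => hlin g0 G hg02' hGT p q)
  have hh2 : ∀ q, MemLp (fun x => g x q - g0 x q) 2 μ := fun q => (hg2' q).sub (hg02' q)
  have hexp : ∀ (k : ℤ) (u : ℝ → ℂ), MemLp u 2 μ →
      Integrable (fun x => u x * Complex.exp (-(Complex.I * (k : ℂ) * (x : ℂ)))) μ := by
    intro k u hu
    have he : MemLp (fun x : ℝ => Complex.exp (-(Complex.I * (k : ℂ) * (x : ℂ)))) 2 μ := by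
      refine (memLp_top_of_bound (Continuous.aestronglyMeasurable (by fun_prop)) 1
        (Filter.Eventually.of_forall fun x => ?_)).mono_exponent le_top
      rw [Complex.norm_exp]
      simp
    exact hu.integrable_mul he
  have h2pi : (1 / (2 * (Real.pi : ℂ))) ≠ 0 := by
    have : (Real.pi : ℂ) ≠ 0 := by exact_mod_cast Real.pi_pos.ne'
    simp [this]
  have horth0 : ∀ q, ∫ x in (-Real.pi)..Real.pi,
      r x q * (starRingEnd ℂ) (g x q - g0 x q) = 0 := by
    intro q
    refine aux_parseval (fun x => r x q) (fun x => g x q - g0 x q) (hr2 q) (hh2 q) fun k => ?_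
    by_cases hk : k ∈ U
    · right
      simp_rw [sub_mul]
      rw [intervalIntegral.integral_sub, hgU k hk q, hg0U k hk q, sub_zero]
      · exact (intervalIntegrable_iff_integrableOn_Ioc_of_le hle).2 (hexp k _ (hg2' q))
      · exact (intervalIntegrable_iff_integrableOn_Ioc_of_le hle).2 (hexp k _ (hg02' q))
    · left
      have hk' : k ∈ Zneg \ S := by
        rw [hU] at hk
        simp only [Set.mem_union, Set.mem_ofPred_eq, not_or, not_le] at hk
        rw [hZneg]
        exact ⟨hk.2, hk.1⟩
      exact (mul_eq_zero.mp (horth k hk' q)).resolve_left h2pi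
  have hcross : ∫ x, ∑ q, r x q * (starRingEnd ℂ) (g x q - g0 x q) ∂μ = 0 := by
    rw [integral_finsetSum _ fun q _ => hmulI _ _ (hr2 q) (hh2 q)]
    refine Finset.sum_eq_zero fun q _ => ?_
    have := horth0 q
    rwa [intervalIntegral.integral_of_le hle] at this
  have hcrossI : Integrable (fun x => ∑ q, r x q * (starRingEnd ℂ) (g x q - g0 x q)) μ :=
    integrable_finsetSum _ fun q _ => hmulI _ _ (hr2 q) (hh2 q)
  have I1 := hquad (fun x p => A x p - g x p) F (fun k => (hA2 k).sub (hg2' k)) hFT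
  have I2 := hquad g G hg2' hGT
  have J1 := hquad (fun x p => A x p - g0 x p) F (fun k => (hA2 k).sub (hg02' k)) hFT
  have J2 := hquad g0 G hg02' hGT
  have hpt : ∀ᵐ x ∂μ,
      ((∑ p, ∑ q, (A x p - g0 x p) * F x p q * (starRingEnd ℂ) (A x q - g0 x q)) +
        (∑ p, ∑ q, g0 x p * G x p q * (starRingEnd ℂ) (g0 x q)) -
        2 * ∑ q, r x q * (starRingEnd ℂ) (g x q - g0 x q)).re ≤
      ((∑ p, ∑ q, (A x p - g x p) * F x p q * (starRingEnd ℂ) (A x q - g x q)) +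
        (∑ p, ∑ q, g x p * G x p q * (starRingEnd ℂ) (g x q))).re := by
    filter_upwards [hFp, hGp] with x h1 h2
    have e1 := aux_psd (F x) h1 (fun p => A x p - g0 x p) (fun p => -(g x p - g0 x p))
    have e2 := aux_psd (G x) h2 (fun p => g0 x p) (fun p => g x p - g0 x p)
    have t1 : ∀ p, A x p - g0 x p + -(g x p - g0 x p) = A x p - g x p := fun p => by ring
    have t2 : ∀ p, g0 x p + (g x p - g0 x p) = g x p := fun p => by ring
    simp only [t1, map_neg, mul_neg, Finset.sum_neg_distrib, Complex.neg_re] at e1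
    simp only [t2] at e2
    have t3 : ∑ q, r x q * (starRingEnd ℂ) (g x q - g0 x q) =
        (∑ q, (∑ p, (A x p - g0 x p) * F x p q) * (starRingEnd ℂ) (g x q - g0 x q)) -
        ∑ q, (∑ p, g0 x p * G x p q) * (starRingEnd ℂ) (g x q - g0 x q) := by
      simp only [hr, sub_mul, Finset.sum_sub_distrib]
    rw [t3]
    simp only [Complex.add_re, Complex.sub_re, Complex.mul_re, Complex.re_ofNat,
      Complex.im_ofNat, zero_mul, sub_zero]
    linarith
  have hfin := integral_mono_ae ((J1.add J2).sub (hcrossI.const_mul 2)).re (I1.add I2).re hpt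
  have hreL := integral_re ((J1.add J2).sub (hcrossI.const_mul 2))
  have hreR := integral_re (I1.add I2)
  rw [hreL, hreR] at hfin
  rw [integral_sub' (J1.add J2) (hcrossI.const_mul 2), integral_add' J1 J2, integral_add' I1 I2,
    integral_const_mul, hcross, mul_zero, sub_zero] at hfin
  have hc : (1 / (2 * (Real.pi : ℂ))) = ((1 / (2 * Real.pi) : ℝ) : ℂ) := by push_cast; rfl
  rw [hΔ, hΔ, ← mul_add, ← mul_add, hc, Complex.re_ofReal_mul, Complex.re_ofReal_mul]
  simp only [intervalIntegral.integral_of_le hle]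
  exact mul_le_mul_of_nonneg_left hfin (by positivity)
end

section
/- Assume the setup below with c solving the normal system: Σ_{j∈Z^S} a(j)^⊤ R(k,j) = Σ_{j∈U} c(j)^⊤ B(k,j) for all k ∈ U. Then the mean-square error of the optimal filter equals Δ(h;F,G) = Σ_{k∈U} ( Σ_{j∈Z^S} a(j)^⊤ R(k,j) ) conj(c(k)) + Σ_{j∈Z^S} Σ_{k∈Z^S} a(j)^⊤ Q(j,k) conj(a(k)), all series converging absolutely (this is formula (55): Δ = ⟨R a, B⁻¹ R a⟩ + ⟨Q a, a⟩, since B c = R a). -/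
open MeasureTheory
open scoped ComplexOrder

section helpers

open scoped Matrix

theorem aux_alg {n : Type*} [Fintype n] [DecidableEq n] (F G P : Matrix n n ℂ)
    (h1 : (F + G) * P = 1) (h2 : P * (F + G) = 1) :
    (G * P) * F * (P * G) + (F * P) * G * (P * F) = F * P * G ∧
    (G * P) * F * P - (F * P) * G * P = 0 ∧
    P * F * (P * G) - P * G * (P * F) = 0 ∧
    P * F * P + P * G * P = P ∧ F - F * P * G = F * P * F := by
  obtain ⟨H, rfl⟩ : ∃ H, G = H - F := ⟨F + G, by abel⟩
  have e : F + (H - F) = H := by abel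
  rw [e] at h1 h2
  have h3 : ∀ X, P * (H * X) = X := fun X => by rw [← mul_assoc, h2, one_mul]
  have h4 : ∀ X, H * (P * X) = X := fun X => by rw [← mul_assoc, h1, one_mul]
  refine ⟨?_, ?_, ?_, ?_, ?_⟩ <;>
    simp only [sub_mul, mul_sub, mul_assoc, h1, h2, h3, h4, mul_one, one_mul] <;> abel

theorem form_eq {n : Type*} [Fintype n] (v w : n → ℂ) (M : Matrix n n ℂ) :
    ∑ p, ∑ q, v p * M p q * (starRingEnd ℂ) (w q) = v ⬝ᵥ (M.mulVec (star w)) := by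
  simp [dotProduct, Matrix.mulVec, Finset.mul_sum, mul_assoc]

theorem form_vecMul {n : Type*} [Fintype n] (v w : n → ℂ) (X M Y : Matrix n n ℂ) :
    (v ᵥ* X) ⬝ᵥ (M.mulVec (star (w ᵥ* Y))) = v ⬝ᵥ ((X * M * Y.conjTranspose).mulVec (star w)) := by
  rw [Matrix.star_vecMul, ← Matrix.dotProduct_mulVec, Matrix.mulVec_mulVec, Matrix.mulVec_mulVec]

theorem form_nonneg {n : Type*} [Fintype n] {M : Matrix n n ℂ} (hM : M.PosSemidef) (v : n → ℂ) :
    0 ≤ v ⬝ᵥ (M.mulVec (star v)) := by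
  simpa using hM.dotProduct_mulVec_nonneg (star v)

theorem psd_entry {n : Type*} [Fintype n] [DecidableEq n] {M N : Matrix n n ℂ} (hM : M.PosSemidef)
    (hN : (N - M).PosSemidef) (p q : n) : ‖M p q‖ ≤ ‖N p p‖ + ‖N q q‖ := by
  have hd : ∀ r, 0 ≤ M r r ∧ ‖M r r‖ ≤ ‖N r r‖ := by
    intro r
    have a := hM.diag_nonneg (i := r)
    have b := hN.diag_nonneg (i := r)
    refine ⟨a, ?_⟩
    rw [Matrix.sub_apply, sub_nonneg] at b
    exact CStarAlgebra.norm_le_norm_of_nonneg_of_le a b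
  have h := (hM.submatrix ![p, q]).det_nonneg
  rw [Matrix.det_fin_two] at h
  simp only [Matrix.submatrix_apply, Matrix.cons_val_zero, Matrix.cons_val_one] at h
  have hs : M q p = star (M p q) := (hM.1.apply q p).symm
  rw [hs, sub_nonneg] at h
  have h0 : 0 ≤ M p q * star (M p q) := mul_star_self_nonneg _
  have h' := CStarAlgebra.norm_le_norm_of_nonneg_of_le h0 h
  rw [norm_mul, norm_mul, norm_star] at h'
  have := (hd p).2
  have := (hd q).2
  nlinarith [norm_nonneg (M p q), norm_nonneg (M p p), norm_nonneg (M q q)]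

theorem pointwise {n : Type*} [Fintype n] [DecidableEq n] (F G : Matrix n n ℂ)
    (hF : F.PosSemidef) (hG : G.PosSemidef) (hu : IsUnit (F + G)) (A C h : n → ℂ)
    (hh : h = Matrix.vecMul A (F * (F + G)⁻¹) - Matrix.vecMul C (F + G)⁻¹) :
    (∀ p q, ‖(F * (F + G)⁻¹ * G) p q‖ ≤ ‖F p p‖ + ‖F q q‖) ∧
    0 ≤ (∑ p, ∑ q, (A p - h p) * F p q * (starRingEnd ℂ) (A q - h q)) ∧
    0 ≤ (∑ p, ∑ q, h p * G p q * (starRingEnd ℂ) (h q)) ∧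
    (∑ p, ∑ q, (A p - h p) * F p q * (starRingEnd ℂ) (A q - h q)) +
      (∑ p, ∑ q, h p * G p q * (starRingEnd ℂ) (h q)) =
    (∑ p, ∑ q, A p * (F * (F + G)⁻¹ * G) p q * (starRingEnd ℂ) (A q)) +
      (∑ p, ∑ q, C p * (F + G)⁻¹ p q * (starRingEnd ℂ) (C q)) := by
  have hd := (Matrix.isUnit_iff_isUnit_det _).1 hu
  have h1 := Matrix.mul_nonsing_inv _ hd
  have h2 := Matrix.nonsing_inv_mul _ hd
  have hP : ((F + G)⁻¹).IsHermitian := (hF.1.add hG.1).inv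
  generalize (F + G)⁻¹ = P at *
  obtain ⟨e1, e2, e3, e4, e5⟩ := aux_alg F G P h1 h2
  have hPe : P.conjTranspose = P := hP
  have hFe : F.conjTranspose = F := hF.1
  have hGe : G.conjTranspose = G := hG.1
  have hAh : A - h = A ᵥ* (G * P) + C ᵥ* P := by
    have : A = A ᵥ* (F * P) + A ᵥ* (G * P) := by
      rw [← Matrix.vecMul_add, ← add_mul, h1, Matrix.vecMul_one]
    rw [hh]
    nth_rewrite 1 [this]
    abel
  have c1 : (∑ p, ∑ q, (A p - h p) * F p q * (starRingEnd ℂ) (A q - h q)) =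
    (A - h) ⬝ᵥ (F.mulVec (star (A - h))) := form_eq (A - h) (A - h) F
  refine ⟨?_, ?_, ?_, ?_⟩
  · intro p q
    refine psd_entry ?_ ?_ p q
    · rw [← e1]
      have a1 := hF.mul_mul_conjTranspose_same (G * P)
      have a2 := hG.mul_mul_conjTranspose_same (F * P)
      rw [Matrix.conjTranspose_mul, hPe, hGe] at a1
      rw [Matrix.conjTranspose_mul, hPe, hFe] at a2
      exact a1.add a2
    · rw [e5]
      have hPp : P.PosSemidef := by
        rw [← e4]
        have a1 := hF.mul_mul_conjTranspose_same P
        have a2 := hG.mul_mul_conjTranspose_same P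
        rw [hPe] at a1 a2
        exact a1.add a2
      have a1 := hPp.mul_mul_conjTranspose_same F
      rwa [hFe] at a1
  · rw [c1]; exact form_nonneg hF _
  · rw [form_eq]; exact form_nonneg hG _
  · rw [c1, form_eq, form_eq, form_eq, hAh, hh]
    simp only [star_add, star_sub, Matrix.mulVec_add, Matrix.mulVec_sub, add_dotProduct,
      sub_dotProduct, dotProduct_add, dotProduct_sub, form_vecMul, Matrix.conjTranspose_mul, hPe,
      hFe, hGe]
    rw [sub_eq_zero] at e2 e3
    have q1 := congrArg (fun M : Matrix n n ℂ => A ⬝ᵥ (M.mulVec (star A))) e1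
    have q2 := congrArg (fun M : Matrix n n ℂ => A ⬝ᵥ (M.mulVec (star C))) e2
    have q3 := congrArg (fun M : Matrix n n ℂ => C ⬝ᵥ (M.mulVec (star A))) e3
    have q4 := congrArg (fun M : Matrix n n ℂ => C ⬝ᵥ (M.mulVec (star C))) e4
    simp only [Matrix.add_mulVec, dotProduct_add] at q1 q2 q3 q4
    linear_combination q1 + q2 + q3 + q4

theorem key {μ : Measure ℝ} (m : ℝ → ℂ) (hm : Integrable m μ) (e : ℤ → ℝ → ℂ)
    (hec : ∀ j, Continuous (e j)) (he : ∀ j x, ‖e j x‖ = 1) (u v : ℤ → ℂ)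
    (hu : Summable fun j => ‖u j‖) (hv : Summable fun j => ‖v j‖) :
    Integrable (fun x => (∑' j, u j * e j x) * m x * (starRingEnd ℂ) (∑' j, v j * e j x)) μ ∧
    HasSum (fun jk : ℤ × ℤ => u jk.1 * (∫ x, m x * (e jk.1 x * (starRingEnd ℂ) (e jk.2 x)) ∂μ)
        * (starRingEnd ℂ) (v jk.2))
      (∫ x, (∑' j, u j * e j x) * m x * (starRingEnd ℂ) (∑' j, v j * e j x) ∂μ) := by
  have cont : ∀ w : ℤ → ℂ, (Summable fun j => ‖w j‖) → Continuous (fun x => ∑' j, w j * e j x) := by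
    intro w hw
    exact continuous_tsum (fun j => continuous_const.mul (hec j)) hw (fun j x => by simp [he])
  have bd : ∀ w : ℤ → ℂ, (Summable fun j => ‖w j‖) → ∀ x, ‖∑' j, w j * e j x‖ ≤ ∑' j, ‖w j‖ := by
    intro w hw x
    refine (norm_tsum_le_tsum_norm (by simpa [he] using hw)).trans (le_of_eq ?_)
    simp [he]
  have hcc : Continuous (starRingEnd ℂ) := Complex.continuous_conj
  constructor
  · have i1 := hm.bdd_mul (cont u hu).aestronglyMeasurable (Filter.Eventually.of_forall (bd u hu))
    exact i1.mul_bdd (c := ∑' j, ‖v j‖) ((hcc.comp (cont v hv)).aestronglyMeasurable)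
      (Filter.Eventually.of_forall (fun x => by simpa using bd v hv x))
  · have hI : ∀ jk : ℤ × ℤ, Integrable (fun x => u jk.1 * (m x * (e jk.1 x *
        (starRingEnd ℂ) (e jk.2 x))) * (starRingEnd ℂ) (v jk.2)) μ := by
      intro jk
      refine Integrable.mul_const (Integrable.const_mul ?_ _) _
      refine hm.mul_bdd (c := 1)
        ((hec _).mul (hcc.comp (hec _))).aestronglyMeasurable
        (Filter.Eventually.of_forall (fun x => by simp [he]))
    have hs : Summable fun jk : ℤ × ℤ => ‖u jk.1‖ * ‖v jk.2‖ :=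
      hu.mul_of_nonneg hv (fun _ => norm_nonneg _) (fun _ => norm_nonneg _)
    have := hasSum_integral_of_summable_integral_norm (μ := μ) hI (by
      refine (hs.mul_right (∫ x, ‖m x‖ ∂μ)).congr ?_
      intro jk
      rw [← integral_const_mul]
      congr 1
      ext x
      simp [he]; ring)
    have E1 : (fun jk : ℤ × ℤ => u jk.1 * (∫ x, m x * (e jk.1 x * (starRingEnd ℂ) (e jk.2 x)) ∂μ)
        * (starRingEnd ℂ) (v jk.2)) = fun jk : ℤ × ℤ => ∫ x, u jk.1 * (m x * (e jk.1 x *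
        (starRingEnd ℂ) (e jk.2 x))) * (starRingEnd ℂ) (v jk.2) ∂μ := by
      funext jk
      rw [integral_mul_const, integral_const_mul]
    have E2 : (fun x => (∑' j, u j * e j x) * m x * (starRingEnd ℂ) (∑' j, v j * e j x)) =
        fun x => ∑' jk : ℤ × ℤ, u jk.1 * (m x * (e jk.1 x *
        (starRingEnd ℂ) (e jk.2 x))) * (starRingEnd ℂ) (v jk.2) := by
      funext x
      have s1 : Summable fun j => ‖u j * e j x‖ := by simpa [he] using hu
      have s2 : Summable fun j => ‖(starRingEnd ℂ) (v j * e j x)‖ := by simpa [he] using hv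
      rw [Complex.conj_tsum, mul_right_comm, tsum_mul_tsum_of_summable_norm s1 s2, ← tsum_mul_right]
      congr 1
      funext jk
      rw [map_mul]; ring
    rw [E1, E2]
    exact this

theorem summable_comp {n : Type*} [Fintype n] {u : ℤ → n → ℂ}
    (hu : Summable fun j => ∑ k, ‖u j k‖) (p : n) : Summable fun j => ‖u j p‖ :=
  Summable.of_nonneg_of_le (fun _ => norm_nonneg _)
    (fun j => Finset.single_le_sum (f := fun k => ‖u j k‖) (fun _ _ => norm_nonneg _)
      (Finset.mem_univ p)) hu

theorem keyMat {n : Type*} [Fintype n] {μ : Measure ℝ} (m : ℝ → Matrix n n ℂ)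
    (hm : ∀ p q, Integrable (fun x => m x p q) μ) (e : ℤ → ℝ → ℂ)
    (hec : ∀ j, Continuous (e j)) (he : ∀ j x, ‖e j x‖ = 1) (u : ℤ → n → ℂ)
    (hu : Summable fun j => ∑ k, ‖u j k‖) (V : ℝ → n → ℂ)
    (hV : ∀ x k, V x k = ∑' j, u j k * e j x) (κ : ℂ) (W : ℤ → ℤ → Matrix n n ℂ)
    (hW : ∀ j k p q, W j k p q =
      κ * ∫ x, m x p q * (e j x * (starRingEnd ℂ) (e k x)) ∂μ) :
    Integrable (fun x => ∑ p, ∑ q, V x p * m x p q * (starRingEnd ℂ) (V x q)) μ ∧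
    HasSum (fun jk : ℤ × ℤ => ∑ p, ∑ q,
        u jk.1 p * W jk.1 jk.2 p q * (starRingEnd ℂ) (u jk.2 q))
      (κ * ∫ x, ∑ p, ∑ q, V x p * m x p q * (starRingEnd ℂ) (V x q) ∂μ) := by
  have K := fun p q => key (fun x => m x p q) (hm p q) e hec he (fun j => u j p) (fun j => u j q)
    (summable_comp hu p) (summable_comp hu q)
  simp only [← hV] at K
  refine ⟨integrable_finsetSum _ fun p _ => integrable_finsetSum _ fun q _ => (K p q).1, ?_⟩
  rw [integral_finsetSum _ fun p _ => integrable_finsetSum _ fun q _ => (K p q).1, Finset.mul_sum]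
  refine hasSum_sum fun p _ => ?_
  rw [integral_finsetSum _ fun q _ => (K p q).1, Finset.mul_sum]
  refine hasSum_sum fun q _ => ?_
  refine ((K p q).2.mul_left κ).congr_fun ?_
  intro jk
  rw [hW]; ring

theorem coef_bdd {n : Type*} [Fintype n] {μ : Measure ℝ} (m : ℝ → Matrix n n ℂ)
    (e : ℤ → ℤ → ℝ → ℂ) (he : ∀ j k x, ‖e j k x‖ = 1) (κ : ℂ) (W : ℤ → ℤ → Matrix n n ℂ)
    (hW : ∀ j k p q, W j k p q = κ * ∫ x, m x p q * e j k x ∂μ) :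
    ∃ K : ℝ, ∀ j k p q, ‖W j k p q‖ ≤ K := by
  refine ⟨∑ p, ∑ q, ‖κ‖ * ∫ x, ‖m x p q‖ ∂μ, fun j k p q => ?_⟩
  have nn : ∀ p q, 0 ≤ ‖κ‖ * ∫ x, ‖m x p q‖ ∂μ := fun p q =>
    mul_nonneg (norm_nonneg _) (integral_nonneg fun _ => norm_nonneg _)
  have h1 : ‖W j k p q‖ ≤ ‖κ‖ * ∫ x, ‖m x p q‖ ∂μ := by
    rw [hW, norm_mul]
    refine mul_le_mul_of_nonneg_left ?_ (norm_nonneg _)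
    refine (norm_integral_le_integral_norm _).trans (le_of_eq ?_)
    simp [he]
  refine h1.trans ((Finset.single_le_sum (f := fun q => ‖κ‖ * ∫ x, ‖m x p q‖ ∂μ)
    (fun q _ => nn p q) (Finset.mem_univ q)).trans ?_)
  exact Finset.single_le_sum (f := fun p => ∑ q, ‖κ‖ * ∫ x, ‖m x p q‖ ∂μ)
    (fun p _ => Finset.sum_nonneg fun q _ => nn p q) (Finset.mem_univ p)

theorem vec_summable {n : Type*} [Fintype n] {u : ℤ → n → ℂ}
    (hu : Summable fun j => ∑ k, ‖u j k‖) (W : ℤ → Matrix n n ℂ) (K : ℝ)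
    (hK : ∀ j p q, ‖W j p q‖ ≤ K) :
    Summable fun j => ∑ q, ‖Matrix.vecMul (u j) (W j) q‖ := by
  refine summable_sum fun q _ => ?_
  refine Summable.of_nonneg_of_le (fun _ => norm_nonneg _) (fun j => ?_) (hu.mul_right K)
  rw [Finset.sum_mul]
  refine (norm_sum_le _ _).trans (Finset.sum_le_sum fun p _ => ?_)
  rw [norm_mul]
  exact mul_le_mul_of_nonneg_left (hK _ _ _) (norm_nonneg _)

end helpers

/-- formula (55): if `c` solves the normal system `B c = R a`, then the
mean-square error of the optimal filter equals
`Δ(h;F,G) = Σ_{k∈U} (Σ_{j∈Z^S} a(j)ᵀ R(k,j)) conj(c(k)) + Σ_{j,k∈Z^S} a(j)ᵀ Q(j,k) conj(a(k))`,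
all series converging absolutely (i.e. `Δ = ⟨R a, B⁻¹ R a⟩ + ⟨Q a, a⟩`). -/
theorem stmt_9
    (T s : ℕ) (hT : 1 ≤ T) (hs : 1 ≤ s)
    (Mb Nb : ℕ → ℕ) (hM1 : 0 < Mb 1)
    (hMN : ∀ l, 1 ≤ l → l < s → Mb l + Nb l < Mb (l + 1))
    (S U ZS : Set ℤ)
    (hS : S = ⋃ l ∈ Finset.Icc 1 s, Set.Icc (-((Mb l : ℤ) + (Nb l : ℤ))) (-(Mb l : ℤ)))
    (hU : U = S ∪ {j : ℤ | 0 ≤ j})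
    (hZS : ZS = {j : ℤ | 1 ≤ j} \ {j : ℤ | -j ∈ S})
    (F G : ℝ → Matrix (Fin T) (Fin T) ℂ)
    (hFmeas : ∀ p q, Measurable fun x => F x p q)
    (hGmeas : ∀ p q, Measurable fun x => G x p q)
    (hFpsd : ∀ᵐ x : ℝ, x ∈ Set.Icc (-Real.pi) Real.pi → (F x).PosSemidef)
    (hGpsd : ∀ᵐ x : ℝ, x ∈ Set.Icc (-Real.pi) Real.pi → (G x).PosSemidef)
    (hFint : ∀ p q, IntervalIntegrable (fun x => F x p q) volume (-Real.pi) Real.pi)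
    (hGint : ∀ p q, IntervalIntegrable (fun x => G x p q) volume (-Real.pi) Real.pi)
    (hinv : ∀ᵐ x : ℝ, x ∈ Set.Icc (-Real.pi) Real.pi → IsUnit (F x + G x))
    (hmin : ∀ p q, IntervalIntegrable (fun x => (F x + G x)⁻¹ p q) volume (-Real.pi) Real.pi)
    (a : ℤ → Fin T → ℂ) (ha0 : ∀ j, j ∉ ZS → a j = 0)
    (haSum : Summable fun j : ℤ => ∑ k, norm (a j k))
    (A : ℝ → Fin T → ℂ)
    (hA : ∀ x k, A x k = ∑' j : ℤ, a j k * Complex.exp (-(Complex.I * (j : ℂ) * (x : ℂ))))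
    (c : ℤ → Fin T → ℂ) (hc0 : ∀ j, j ∉ U → c j = 0)
    (hcSum : Summable fun j : ℤ => ∑ k, norm (c j k))
    (Cf : ℝ → Fin T → ℂ)
    (hCf : ∀ x k, Cf x k = ∑' j : ℤ, c j k * Complex.exp (Complex.I * (j : ℂ) * (x : ℂ)))
    (h : ℝ → Fin T → ℂ)
    (hh : ∀ x, h x = Matrix.vecMul (A x) (F x * (F x + G x)⁻¹) -
      Matrix.vecMul (Cf x) (F x + G x)⁻¹)
    (B R Q : ℤ → ℤ → Matrix (Fin T) (Fin T) ℂ)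
    (hB : ∀ k j p q, B k j p q = (1 / (2 * (Real.pi : ℂ))) *
      ∫ x in (-Real.pi)..Real.pi,
        (F x + G x)⁻¹ p q * Complex.exp (-(Complex.I * ((k : ℂ) - (j : ℂ)) * (x : ℂ))))
    (hR : ∀ k j p q, R k j p q = (1 / (2 * (Real.pi : ℂ))) *
      ∫ x in (-Real.pi)..Real.pi,
        (F x * (F x + G x)⁻¹) p q * Complex.exp (-(Complex.I * ((k : ℂ) + (j : ℂ)) * (x : ℂ))))
    (hQ : ∀ k j p q, Q k j p q = (1 / (2 * (Real.pi : ℂ))) *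
      ∫ x in (-Real.pi)..Real.pi,
        (F x * (F x + G x)⁻¹ * G x) p q *
          Complex.exp (-(Complex.I * ((k : ℂ) - (j : ℂ)) * (x : ℂ))))
    (Δ : (ℝ → Fin T → ℂ) → ℂ)
    (hΔ : ∀ g : ℝ → Fin T → ℂ, Δ g =
      (1 / (2 * (Real.pi : ℂ))) * (∫ x in (-Real.pi)..Real.pi,
        ∑ p, ∑ q, (A x p - g x p) * F x p q * (starRingEnd ℂ) (A x q - g x q)) +
      (1 / (2 * (Real.pi : ℂ))) * (∫ x in (-Real.pi)..Real.pi,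
        ∑ p, ∑ q, g x p * G x p q * (starRingEnd ℂ) (g x q)))
    (hnormal : ∀ k ∈ U,
      (∑' j : ℤ, Matrix.vecMul (a j) (R k j)) = ∑' j : ℤ, Matrix.vecMul (c j) (B k j)) :
    (∀ k : ℤ, Summable (fun j : ℤ => ∑ q, norm (Matrix.vecMul (a j) (R k j) q))) ∧
    Summable (fun k : ℤ => norm
      (∑ q, (∑' j : ℤ, Matrix.vecMul (a j) (R k j)) q * (starRingEnd ℂ) (c k q))) ∧
    Summable (fun jk : ℤ × ℤ => norm
      (∑ p, ∑ q, a jk.1 p * Q jk.1 jk.2 p q * (starRingEnd ℂ) (a jk.2 q))) ∧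
    Δ h = (∑' k : ℤ, ∑ q,
        (∑' j : ℤ, Matrix.vecMul (a j) (R k j)) q * (starRingEnd ℂ) (c k q)) +
      ∑' jk : ℤ × ℤ, ∑ p, ∑ q,
        a jk.1 p * Q jk.1 jk.2 p q * (starRingEnd ℂ) (a jk.2 q) := by
  have hpi : -Real.pi ≤ Real.pi := by linarith [Real.pi_pos]
  simp only [intervalIntegrable_iff_integrableOn_Ioc_of_le hpi, IntegrableOn] at hFint hGint hmin
  simp only [intervalIntegral.integral_of_le hpi] at hB hR hQ hΔ
  have aeμ : ∀ p : ℝ → Prop, (∀ᵐ x : ℝ, x ∈ Set.Icc (-Real.pi) Real.pi → p x) →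
      ∀ᵐ x ∂(volume.restrict (Set.Ioc (-Real.pi) Real.pi)), p x := by
    intro p hp
    rw [ae_restrict_iff' measurableSet_Ioc]
    filter_upwards [hp] with x hx hx' using hx (Set.Ioc_subset_Icc_self hx')
  have hF' := aeμ _ hFpsd
  have hG' := aeμ _ hGpsd
  have hI' := aeμ _ hinv
  generalize volume.restrict (Set.Ioc (-Real.pi) Real.pi) = μ at *
  generalize (1 / (2 * (Real.pi : ℂ))) = κ at *
  have hPM := (hF'.and (hG'.and hI')).mono fun x hx =>
    pointwise (F x) (G x) hx.1 hx.2.1 hx.2.2 (A x) (Cf x) (h x) (hh x)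
  have mF : ∀ p q, AEStronglyMeasurable (fun x => F x p q) μ := fun p q =>
    (hFmeas p q).aestronglyMeasurable
  have mG : ∀ p q, AEStronglyMeasurable (fun x => G x p q) μ := fun p q =>
    (hGmeas p q).aestronglyMeasurable
  have mP : ∀ p q, AEStronglyMeasurable (fun x => (F x + G x)⁻¹ p q) μ := fun p q =>
    (hmin p q).aestronglyMeasurable
  have mFP : ∀ p q, AEStronglyMeasurable (fun x => (F x * (F x + G x)⁻¹) p q) μ := by
    intro p q
    simp only [Matrix.mul_apply]
    exact Finset.aestronglyMeasurable_fun_sum _ fun r _ => (mF p r).mul (mP r q)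
  have mM : ∀ p q, AEStronglyMeasurable (fun x => (F x * (F x + G x)⁻¹ * G x) p q) μ := by
    intro p q
    simp only [Matrix.mul_apply (M := _ * _)]
    exact Finset.aestronglyMeasurable_fun_sum _ fun r _ => (mFP p r).mul (mG r q)
  have hM : ∀ p q, Integrable (fun x => (F x * (F x + G x)⁻¹ * G x) p q) μ := by
    intro p q
    refine Integrable.mono' ((hFint p p).norm.add (hFint q q).norm) (mM p q) ?_
    filter_upwards [hPM] with x hx using hx.1 p q
  have eAc : ∀ j : ℤ, Continuous fun x : ℝ => Complex.exp (-(Complex.I * (j : ℂ) * (x : ℂ))) := by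
    intro j; fun_prop
  have eCc : ∀ j : ℤ, Continuous fun x : ℝ => Complex.exp (Complex.I * (j : ℂ) * (x : ℂ)) := by
    intro j; fun_prop
  have eA1 : ∀ (j : ℤ) (x : ℝ), ‖Complex.exp (-(Complex.I * (j : ℂ) * (x : ℂ)))‖ = 1 := by
    intro j x; simp [Complex.norm_exp]
  have eC1 : ∀ (j : ℤ) (x : ℝ), ‖Complex.exp (Complex.I * (j : ℂ) * (x : ℂ))‖ = 1 := by
    intro j x; simp [Complex.norm_exp]
  obtain ⟨iA, sA⟩ := keyMat (fun x => F x * (F x + G x)⁻¹ * G x) hM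
    (fun j x => Complex.exp (-(Complex.I * (j : ℂ) * (x : ℂ)))) eAc eA1 a haSum A hA κ Q (by
      intro j k p q
      rw [hQ]
      congr 2
      funext x
      rw [← Complex.exp_conj, ← Complex.exp_add]
      congr 2
      simp; ring)
  obtain ⟨iC, sC⟩ := keyMat (fun x => (F x + G x)⁻¹) hmin
    (fun j x => Complex.exp (Complex.I * (j : ℂ) * (x : ℂ))) eCc eC1 c hcSum Cf hCf κ
    (fun j k => B k j) (by
      intro j k p q
      rw [hB]
      congr 2
      funext x
      rw [← Complex.exp_conj, ← Complex.exp_add]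
      congr 2
      simp; ring)
  have mA : ∀ k, AEStronglyMeasurable (fun x => A x k) μ := by
    intro k
    simp only [hA]
    exact (continuous_tsum (fun j => continuous_const.mul (eAc j)) (summable_comp haSum k)
      (fun j x => by
        rw [Pi.mul_apply, norm_mul, eA1, mul_one])).aestronglyMeasurable
  have mC : ∀ k, AEStronglyMeasurable (fun x => Cf x k) μ := by
    intro k
    simp only [hCf]
    exact (continuous_tsum (fun j => continuous_const.mul (eCc j)) (summable_comp hcSum k)
      (fun j x => by
        rw [Pi.mul_apply, norm_mul, eC1, mul_one])).aestronglyMeasurable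
  have mh : ∀ k, AEStronglyMeasurable (fun x => h x k) μ := by
    intro k
    simp only [hh, Pi.sub_apply, Matrix.vecMul, dotProduct]
    exact (Finset.aestronglyMeasurable_fun_sum _ fun r _ => (mA r).mul (mFP r k)).sub
      (Finset.aestronglyMeasurable_fun_sum _ fun r _ => (mC r).mul (mP r k))
  have hcc : Continuous (starRingEnd ℂ) := Complex.continuous_conj
  have i1 : Integrable (fun x => ∑ p, ∑ q, (A x p - h x p) * F x p q *
      (starRingEnd ℂ) (A x q - h x q)) μ := by
    refine Integrable.mono (iA.add iC) (Finset.aestronglyMeasurable_fun_sum _ fun p _ =>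
      Finset.aestronglyMeasurable_fun_sum _ fun q _ => (((mA p).sub (mh p)).mul (mF p q)).mul
        (hcc.comp_aestronglyMeasurable ((mA q).sub (mh q)))) ?_
    filter_upwards [hPM] with x hx
    rw [Pi.add_apply, ← hx.2.2.2]
    exact CStarAlgebra.norm_le_norm_of_nonneg_of_le hx.2.1 (le_add_of_nonneg_right hx.2.2.1)
  have i2 : Integrable (fun x => ∑ p, ∑ q, h x p * G x p q * (starRingEnd ℂ) (h x q)) μ := by
    refine Integrable.mono (iA.add iC) (Finset.aestronglyMeasurable_fun_sum _ fun p _ =>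
      Finset.aestronglyMeasurable_fun_sum _ fun q _ => ((mh p).mul (mG p q)).mul
        (hcc.comp_aestronglyMeasurable (mh q))) ?_
    filter_upwards [hPM] with x hx
    rw [Pi.add_apply, ← hx.2.2.2]
    exact CStarAlgebra.norm_le_norm_of_nonneg_of_le hx.2.2.1 (le_add_of_nonneg_left hx.2.1)
  have hΔh : Δ h = (∑' jk : ℤ × ℤ, ∑ p, ∑ q,
        c jk.1 p * B jk.2 jk.1 p q * (starRingEnd ℂ) (c jk.2 q)) +
      ∑' jk : ℤ × ℤ, ∑ p, ∑ q,
        a jk.1 p * Q jk.1 jk.2 p q * (starRingEnd ℂ) (a jk.2 q) := by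
    rw [hΔ, sA.tsum_eq, sC.tsum_eq, ← mul_add, ← mul_add, ← integral_add i1 i2,
      ← integral_add iC iA]
    congr 1
    refine integral_congr_ae ?_
    filter_upwards [hPM] with x hx
    rw [hx.2.2.2, add_comm]
  obtain ⟨KR, hKR⟩ := coef_bdd (fun x => F x * (F x + G x)⁻¹)
    (fun k j x => Complex.exp (-(Complex.I * ((k : ℂ) + (j : ℂ)) * (x : ℂ))))
    (fun k j x => by simp [Complex.norm_exp]) κ R hR
  obtain ⟨KB, hKB⟩ := coef_bdd (fun x => (F x + G x)⁻¹)
    (fun k j x => Complex.exp (-(Complex.I * ((k : ℂ) - (j : ℂ)) * (x : ℂ))))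
    (fun k j x => by simp [Complex.norm_exp]) κ B hB
  have sB : ∀ k, Summable fun j => Matrix.vecMul (c j) (B k j) := by
    intro k
    rw [Pi.summable]
    intro q
    exact (summable_comp (vec_summable hcSum (B k) KB (hKB k)) q).of_norm
  have hterm : ∀ k, (∑ q, (∑' j : ℤ, Matrix.vecMul (a j) (R k j)) q * (starRingEnd ℂ) (c k q)) =
      ∑' j, ∑ p, ∑ q, c j p * B k j p q * (starRingEnd ℂ) (c k q) := by
    intro k
    by_cases hk : k ∈ U
    · have sB' := fun q => Pi.summable.1 (sB k) q
      rw [hnormal k hk]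
      simp only [tsum_apply (sB k), ← tsum_mul_right]
      rw [← Summable.tsum_finsetSum fun q _ => (sB' q).mul_right _]
      congr 1
      funext j
      rw [Finset.sum_comm]
      simp only [Matrix.vecMul, dotProduct, Finset.sum_mul]
    · simp [hc0 k hk]
  have sC' := sC.summable.prod_symm
  refine ⟨fun k => vec_summable haSum (R k) KR (hKR k), ?_, sA.summable.norm, ?_⟩
  · simp only [hterm]
    exact sC'.prod.norm
  · rw [hΔh]
    congr 1
    simp only [hterm]
    exact ((Equiv.prodComm ℤ ℤ).tsum_eq _).symm.trans sC'.tsum_prod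
end
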